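/- arXiv:1311.1616 — 8 statements merged into one kernel-verified Lean document; each statement's English description precedes it below -/
import Mathlib

section
/- Let f : {-1,1}^m → {-1,1} be a Boolean function whose one-sided (1/2)-approximate degree satisfies odeg_{1/2}(f) > d, and let t ≥ 1 be an integer. Let F = OR_t(f,…,f) : ({-1,1}^m)^t → {-1,1} be the block composition of OR_t with t disjoint copies of f. Then the (1 − 2^{−t})-approximate degree of F exceeds d; that is, for every real polynomial p of degree at most d on ({-1,1}^m)^t there exists an input x with |p(x) − F(x)| > 1 − 2^{−t}. -/
open Finset

noncomputable section

/-- The real value of a Boolean bit: `true` encodes `-1` (logical TRUE), `false` encodes `1`. -/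
def bval (b : Bool) : ℝ := if b then -1 else 1

/-- The parity character `χ_S(x) = ∏_{i ∈ S} x_i`. -/
def chi {ι : Type*} (S : Finset ι) (x : ι → Bool) : ℝ := ∏ i ∈ S, bval (x i)

/-- The multilinear polynomial with coefficient family `c`. -/
def polyOf {ι : Type*} [Fintype ι] (c : Finset ι → ℝ) (x : ι → Bool) : ℝ :=
  ∑ S : Finset ι, c S * chi S x

/-- The coefficient family `c` has degree at most `d`. -/
def degLE {ι : Type*} (c : Finset ι → ℝ) (d : ℕ) : Prop :=
  ∀ S : Finset ι, d < S.card → c S = 0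

/-- `p` is an `ε`-one-sided approximation to the Boolean function `f`. -/
def IsOneSided {ι : Type*} (f : (ι → Bool) → Bool) (p : (ι → Bool) → ℝ) (ε : ℝ) : Prop :=
  (∀ x, f x = false → |p x - 1| ≤ ε) ∧ (∀ x, f x = true → p x ≤ -1 + ε)

/-- The block composition `OR_t(f, …, f)`; it is TRUE (`true`, i.e. `-1`) iff some copy of
`f` is TRUE. -/
def orBlock (t : ℕ) {ι : Type*} [Fintype ι] [DecidableEq ι]
    (f : (ι → Bool) → Bool) (x : Fin t × ι → Bool) : Bool :=
  decide (∃ i : Fin t, f (fun j => x (i, j)) = true)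

/-- The functions represented by polynomials of degree at most `d`. -/
def lowDeg (m d : ℕ) : Submodule ℝ ((Fin m → Bool) → ℝ) where
  carrier := {q | ∃ c : Finset (Fin m) → ℝ, degLE c d ∧ polyOf c = q}
  add_mem' := by
    rintro _ _ ⟨c, hc, rfl⟩ ⟨c', hc', rfl⟩
    refine ⟨c + c', fun S hS => by simp [hc S hS, hc' S hS], ?_⟩
    funext x
    simp [polyOf, add_mul, Finset.sum_add_distrib]
  zero_mem' := ⟨0, fun S hS => rfl, by funext x; simp [polyOf]⟩
  smul_mem' := by
    rintro k _ ⟨c, hc, rfl⟩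
    refine ⟨k • c, fun S hS => by simp [hc S hS], ?_⟩
    funext x
    simp [polyOf, Finset.mul_sum, mul_assoc]

lemma chi_mem_lowDeg {m d : ℕ} (S : Finset (Fin m)) (hS : S.card ≤ d) :
    chi S ∈ lowDeg m d := by
  classical
  refine ⟨Pi.single S 1, ?_, ?_⟩
  · intro T hT
    have : T ≠ S := by rintro rfl; omega
    simp [this]
  · funext x
    simp [polyOf, Pi.single_apply]

lemma section_mem_lowDeg {m d t : ℕ} (c : Finset (Fin t × Fin m) → ℝ) (hc : degLE c d)
    (x : Fin t → Fin m → Bool) (i : Fin t) :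
    (fun y => polyOf c (fun ij => Function.update x i y ij.1 ij.2)) ∈ lowDeg m d := by
  classical
  have key : (fun y => polyOf c (fun ij => Function.update x i y ij.1 ij.2)) =
      ∑ S : Finset (Fin t × Fin m),
        (c S * ∏ ij ∈ S.filter (fun ij => ¬ ij.1 = i), bval (x ij.1 ij.2)) •
          chi ((S.filter (fun ij => ij.1 = i)).image Prod.snd) := by
    funext y
    simp only [polyOf, Finset.sum_apply, Pi.smul_apply, smul_eq_mul]
    refine Finset.sum_congr rfl fun S _ => ?_
    rw [mul_assoc]
    congr 1
    unfold chi
    rw [← Finset.prod_filter_mul_prod_filter_not S (fun ij => ij.1 = i), mul_comm]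
    congr 1
    · refine Finset.prod_congr rfl fun ij hij => ?_
      dsimp only
      rw [Function.update_of_ne (Finset.mem_filter.1 hij).2]
    · rw [Finset.prod_image]
      · refine Finset.prod_congr rfl fun ij hij => ?_
        dsimp only
        rw [(Finset.mem_filter.1 hij).2, Function.update_self]
      · rintro ⟨a, b⟩ h1 ⟨a', b'⟩ h2 h
        simp at h1 h2 h
        simp [h1.2, h2.2, h]
  rw [key]
  refine Submodule.sum_mem _ fun S _ => ?_
  by_cases hS : d < S.card
  · rw [hc S hS]; simp
  · refine Submodule.smul_mem _ _ (chi_mem_lowDeg _ ?_)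
    exact (Finset.card_image_le.trans (Finset.card_filter_le _ _)).trans (not_lt.1 hS)

/-- Dual witness for one-sided approximation. -/
lemma dual_witness {Y : Type*} [Fintype Y] (V : Submodule ℝ (Y → ℝ))
    (h1 : (fun _ => (1 : ℝ)) ∈ V) (f : Y → Bool)
    (hV : ∀ q ∈ V, ¬ ((∀ x, f x = false → |q x - 1| ≤ 1/2) ∧
      (∀ x, f x = true → q x ≤ -1 + 1/2))) :
    ∃ a b : Y → ℝ, (∀ y, 0 ≤ a y) ∧ (∀ y, 0 ≤ b y) ∧
      (∀ y, f y = true → a y = 0) ∧ ∑ y, a y = 1 ∧ ∑ y, b y = 1 ∧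
      ∑ y, (if f y = true then 0 else b y) ≤ 1/2 ∧
      ∀ q ∈ V, ∑ y, a y * q y = ∑ y, b y * q y := by
  classical
  let I : Y → Set ℝ := fun y => if f y = true then Set.Iio (-1/2) else Set.Ioo (1/2) (3/2)
  have hIc : ∀ y, Convex ℝ (I y) := by
    intro y; dsimp [I]; split_ifs
    · exact convex_Iio _
    · exact convex_Ioo _ _
  have hIo : ∀ y, IsOpen (I y) := by
    intro y; dsimp [I]; split_ifs
    · exact isOpen_Iio
    · exact isOpen_Ioo
  have hdis : Disjoint (Set.univ.pi I) (V : Set (Y → ℝ)) := by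
    rw [Set.disjoint_left]
    intro q hq hqV
    refine hV q hqV ⟨fun x hx => ?_, fun x hx => ?_⟩
    · have := hq x trivial
      simp only [I, hx] at this
      simp at this
      rw [abs_le]; constructor <;> linarith [this.1, this.2]
    · have := hq x trivial
      simp only [I, hx] at this
      simp at this
      linarith
  obtain ⟨g, u, hg, hgV⟩ := geometric_hahn_banach_open
    (convex_pi fun y _ => hIc y) (isOpen_set_pi Set.finite_univ fun y _ => hIo y)
    V.convex hdis
  have hu : u ≤ 0 := by simpa using hgV 0 V.zero_mem
  have hgz : ∀ v ∈ V, g v = 0 := by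
    intro v hv
    by_contra hne
    have := hgV (((u - 1) / g v) • v) (V.smul_mem _ hv)
    rw [map_smul, smul_eq_mul, div_mul_cancel₀ _ hne] at this
    linarith
  let φ : Y → ℝ := fun y => g (fun j => if y = j then 1 else 0)
  have hgs : ∀ q : Y → ℝ, g q = ∑ y, φ y * q y := by
    intro q
    have := LinearMap.pi_apply_eq_sum_univ (g : (Y → ℝ) →ₗ[ℝ] ℝ) q
    simp only [ContinuousLinearMap.coe_coe, smul_eq_mul] at this
    rw [this]
    exact Finset.sum_congr rfl fun y _ => mul_comm _ _
  have hneg : ∀ q : Y → ℝ, (∀ y, q y ∈ I y) → ∑ y, φ y * q y < 0 := by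
    intro q hq
    rw [← hgs]
    exact (hg q fun y _ => hq y).trans_le hu
  have hφT : ∀ y, f y = true → 0 ≤ φ y := by
    intro y0 hy0
    by_contra hlt
    push Not at hlt
    let q0 : Y → ℝ := fun y => if f y = true then -1 else 1
    have hq0 : ∀ y, q0 y ∈ I y := by
      intro y; dsimp [q0, I]; split_ifs <;> norm_num
    set K := ∑ y, φ y * q0 y with hK
    have hK0 : K < 0 := hneg q0 hq0
    have h2 : 0 ≤ K / φ y0 := by
      apply div_nonneg_of_nonpos <;> linarith
    have := hneg (fun y => q0 y - if y = y0 then K / φ y0 else 0) (by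
      intro y
      by_cases h : y = y0
      · subst h
        simp only [q0, I, hy0, if_true, Set.mem_Iio]
        linarith
      · simpa [h] using hq0 y)
    simp only [mul_sub, Finset.sum_sub_distrib, mul_ite, mul_zero, Finset.sum_ite_eq',
      Finset.mem_univ, if_true] at this
    rw [mul_div_cancel₀ _ hlt.ne] at this
    linarith
  let a : Y → ℝ := fun y => max (-φ y) 0
  let b : Y → ℝ := fun y => max (φ y) 0
  have hab : ∀ y, φ y = b y - a y := by
    intro y; dsimp [a, b]
    rcases le_total 0 (φ y) with h | h
    · rw [max_eq_left h, max_eq_right (by linarith)]; ring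
    · rw [max_eq_right h, max_eq_left (by linarith)]; ring
  have ha0 : ∀ y, 0 ≤ a y := fun y => le_max_right _ _
  have hb0 : ∀ y, 0 ≤ b y := fun y => le_max_right _ _
  have haT : ∀ y, f y = true → a y = 0 := fun y hy =>
    max_eq_right (by linarith [hφT y hy])
  have hVab : ∀ q ∈ V, ∑ y, a y * q y = ∑ y, b y * q y := by
    intro q hq
    have := hgz q hq
    rw [hgs] at this
    simp only [hab, sub_mul, Finset.sum_sub_distrib] at this
    linarith
  have hsum : ∑ y, a y = ∑ y, b y := by simpa using hVab _ h1
  set A := ∑ y, a y with hA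
  have hA0 : 0 ≤ A := Finset.sum_nonneg fun y _ => ha0 y
  set B := ∑ y, (if f y = true then 0 else b y) with hB
  -- the vertex
  have hvert : ∀ s : ℝ, 0 < s → s < 1/2 →
      ∑ y, φ y * (if f y = true then -1/2 - s else if φ y < 0 then 1/2 + s else 3/2 - s) < 0 := by
    intro s hs hs'
    apply hneg
    intro y; dsimp [I]
    split_ifs
    · simp only [Set.mem_Iio]; linarith
    · constructor <;> linarith
    · constructor <;> linarith
  have hcalc : ∀ s : ℝ,
      ∑ y, φ y * (if f y = true then -1/2 - s else if φ y < 0 then 1/2 + s else 3/2 - s)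
      = 2 * B - A - s * (2 * A) := by
    intro s
    have e : 2 * B - A - s * (2 * A) = 2 * B - (1/2) * ∑ y, b y - (1/2) * ∑ y, a y
      - s * ∑ y, b y - s * ∑ y, a y := by rw [← hsum]; ring
    rw [e, hB]
    simp only [Finset.mul_sum, ← Finset.sum_sub_distrib]
    refine Finset.sum_congr rfl fun y _ => ?_
    by_cases h : f y = true
    · simp only [h, if_true, haT y h]
      rw [hab y, haT y h]; ring
    · by_cases h' : φ y < 0
      · have hb : b y = 0 := max_eq_right h'.le
        simp only [h, h', if_true, if_false, hb]
        rw [hab y, hb]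
        simp; ring
      · have ha : a y = 0 := max_eq_right (by linarith)
        simp only [h, h', if_false, ha]
        rw [hab y, ha]
        simp; ring
  have hApos : 0 < A := by
    rcases hA0.lt_or_eq with h | h
    · exact h
    · exfalso
      have hbz : B ≥ 0 := Finset.sum_nonneg fun y _ => by
        split_ifs
        · exact le_rfl
        · exact hb0 y
      have := hvert (1/4) (by norm_num) (by norm_num)
      rw [hcalc, ← h] at this
      linarith
  have hBA : 2 * B ≤ A := by
    by_contra hlt
    push Not at hlt
    have hd : 0 < (2 * B - A) / (2 * A) := div_pos (by linarith) (by linarith)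
    have hm : 0 < min (1/4) ((2 * B - A) / (2 * A)) := lt_min (by norm_num) hd
    have := hvert _ hm ((min_le_left _ _).trans_lt (by norm_num))
    rw [hcalc] at this
    have h3 := (le_div_iff₀ (by linarith : 0 < 2 * A)).1 (min_le_right (1/4) ((2 * B - A) / (2 * A)))
    linarith
  refine ⟨fun y => a y / A, fun y => b y / A, fun y => div_nonneg (ha0 y) hA0,
    fun y => div_nonneg (hb0 y) hA0, fun y hy => by simp [haT y hy], ?_, ?_, ?_, ?_⟩
  · rw [← Finset.sum_div]; exact div_self hApos.ne'
  · rw [← Finset.sum_div, ← hsum]; exact div_self hApos.ne'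
  · have : ∑ y, (if f y = true then 0 else b y / A) = B / A := by
      rw [hB, Finset.sum_div]
      refine Finset.sum_congr rfl fun y _ => ?_
      split_ifs <;> simp
    rw [this, div_le_iff₀ hApos]; linarith
  · intro q hq
    have := hVab q hq
    simp only [div_mul_eq_mul_div, ← Finset.sum_div, this]

lemma amplify {Y : Type*} [Fintype Y] (V : Submodule ℝ (Y → ℝ))
    (h1 : (fun _ => (1 : ℝ)) ∈ V) (f : Y → Bool)
    (hV : ∀ q ∈ V, ¬ ((∀ x, f x = false → |q x - 1| ≤ 1/2) ∧
      (∀ x, f x = true → q x ≤ -1 + 1/2))) (L M : ℝ) (hLM : M < L) :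
    ∀ (t : ℕ) (p : (Fin (t + 1) → Y) → ℝ)
      (_ : ∀ x i, (fun y => p (Function.update x i y)) ∈ V) (U : ℝ)
      (_ : U - L ≤ (2 ^ (t + 1) - 1) * (L - M))
      (_ : ∀ x, (∀ i, f (x i) = false) → L ≤ p x ∧ p x ≤ U)
      (_ : ∀ x, (∃ i, f (x i) = true) → p x ≤ M), False := by
  intro t
  induction t with
  | zero =>
    intro p hp U hU hF hT
    have hD : 0 < L - M := by linarith
    cases isEmpty_or_nonempty Y with
    | inl hY => exact hV 0 V.zero_mem ⟨fun x => hY.elim x, fun x => hY.elim x⟩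
    | inr hY =>
    obtain ⟨y0⟩ := hY
    have hq := hp (fun _ => y0) 0
    have hup : ∀ y, Function.update (fun _ : Fin (0 + 1) => y0) 0 y = fun _ => y := by
      intro y; funext i
      have : i = 0 := Fin.ext (by omega)
      subst this; simp
    simp only [hup] at hq
    have hq' := V.smul_mem (1 / (L - M)) (V.sub_mem hq (V.smul_mem ((L + M) / 2) h1))
    refine hV _ hq' ⟨fun y hy => ?_, fun y hy => ?_⟩
    · obtain ⟨h2, h3⟩ := hF (fun _ => y) (fun _ => hy)
      simp only [Pi.smul_apply, Pi.sub_apply, smul_eq_mul, mul_one]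
      rw [one_div, inv_mul_eq_div, div_sub_one hD.ne', abs_div, abs_of_pos hD, div_le_iff₀ hD, abs_le]
      norm_num at hU
      constructor <;> linarith
    · have h2 := hT (fun _ => y) ⟨0, hy⟩
      simp only [Pi.smul_apply, Pi.sub_apply, smul_eq_mul, mul_one]
      rw [one_div, inv_mul_eq_div, div_le_iff₀ hD]
      linarith
  | succ t ih =>
    intro p hp U hU hF hT
    obtain ⟨a, b, ha0, hb0, haT, hasum, hbsum, hbF, hab⟩ := dual_witness V h1 f hV
    have hUL : L ≤ U := by
      have : ∃ y, f y = false := by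
        by_contra hno
        push Not at hno
        have : ∑ y, a y = 0 := Finset.sum_eq_zero fun y _ => haT y (by simpa using hno y)
        linarith
      obtain ⟨y, hy⟩ := this
      have := hF (fun _ => y) (fun _ => hy)
      linarith
    refine ih (fun x => ∑ y, a y * p (Fin.cons y x)) ?_ ((U + M) / 2) ?_ ?_ ?_
    · intro x i
      have : (fun z => ∑ y, a y * p (Fin.cons y (Function.update x i z))) =
          ∑ y, a y • (fun z => p (Function.update (Fin.cons y x : Fin (t + 1 + 1) → Y) i.succ z)) := by
        funext z
        simp only [Finset.sum_apply, Pi.smul_apply, smul_eq_mul]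
        refine Finset.sum_congr rfl fun y _ => ?_
        rw [Fin.cons_update]
      rw [this]
      exact V.sum_mem fun y _ => V.smul_mem _ (hp _ _)
    · rw [pow_succ] at hU
      linarith
    · intro x hx
      constructor
      · calc L = ∑ y, a y * L := by rw [← Finset.sum_mul, hasum, one_mul]
          _ ≤ _ := Finset.sum_le_sum fun y _ => by
            by_cases hy : f y = true
            · rw [haT y hy]; simp
            · refine mul_le_mul_of_nonneg_left (hF _ ?_).1 (ha0 y)
              intro i
              refine Fin.cases ?_ (fun i => ?_) i
              · simpa using hy
              · simpa using hx i
      · have hsec : (fun y => p (Fin.cons y x)) ∈ V := by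
          cases isEmpty_or_nonempty Y with
          | inl hY => simp at hasum
          | inr hY =>
          obtain ⟨y0⟩ := hY
          have := hp (Fin.cons y0 x) 0
          simpa only [Fin.update_cons_zero] using this
        have e := hab _ hsec
        rw [e]
        calc ∑ y, b y * p (Fin.cons y x)
            ≤ ∑ y, (b y * M + (if f y = true then 0 else b y) * (U - M)) :=
              Finset.sum_le_sum fun y _ => by
                by_cases hy : f y = true
                · simp only [hy, if_true, zero_mul, add_zero]
                  refine mul_le_mul_of_nonneg_left (hT _ ⟨0, ?_⟩) (hb0 y)
                  simpa using hy
                · simp only [hy]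
                  have : p (Fin.cons y x) ≤ U := by
                    refine (hF _ ?_).2
                    intro i
                    refine Fin.cases ?_ (fun i => ?_) i
                    · simpa using hy
                    · simpa using hx i
                  have := mul_le_mul_of_nonneg_left this (hb0 y)
                  simp
                  linarith
          _ = M + (∑ y, (if f y = true then 0 else b y)) * (U - M) := by
              rw [Finset.sum_add_distrib, ← Finset.sum_mul, ← Finset.sum_mul, hbsum, one_mul]
          _ ≤ (U + M) / 2 := by
              have := mul_le_mul_of_nonneg_right hbF (by linarith : 0 ≤ U - M)
              linarith
    · rintro x ⟨i, hi⟩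
      calc ∑ y, a y * p (Fin.cons y x) ≤ ∑ y, a y * M := Finset.sum_le_sum fun y _ =>
            mul_le_mul_of_nonneg_left (hT _ ⟨i.succ, by simpa using hi⟩) (ha0 y)
        _ = M := by rw [← Finset.sum_mul, hasum, one_mul]

/-- If `odeg_{1/2}(f) > d` then the `(1 - 2^{-t})`-approximate degree of
`OR_t(f, …, f)` exceeds `d`. -/
theorem hardness_amplification (m d t : ℕ) (ht : 1 ≤ t)
    (f : (Fin m → Bool) → Bool)
    (hf : ∀ c : Finset (Fin m) → ℝ, degLE c d → ¬ IsOneSided f (polyOf c) (1/2)) :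
    ∀ c : Finset (Fin t × Fin m) → ℝ, degLE c d →
      ∃ x : Fin t × Fin m → Bool,
        1 - (1/2) ^ t < |polyOf c x - bval (orBlock t f x)| := by
  intro c hc
  by_contra hno
  push Not at hno
  obtain ⟨t, rfl⟩ : ∃ s, t = s + 1 := ⟨t - 1, by omega⟩
  have hpos : (0 : ℝ) < (1/2) ^ (t + 1) := by positivity
  refine amplify (lowDeg m d) ?_ f ?_ ((1/2) ^ (t + 1)) (-(1/2) ^ (t + 1)) (by linarith) t
    (fun x => polyOf c (fun ij => x ij.1 ij.2)) (fun x i => section_mem_lowDeg c hc x i)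
    (2 - (1/2) ^ (t + 1)) ?_ ?_ ?_
  · have h := chi_mem_lowDeg (m := m) (d := d) ∅ (by simp)
    have e : (fun _ => (1 : ℝ)) = chi (∅ : Finset (Fin m)) := by
      funext x; simp [chi]
    rw [e]; exact h
  · rintro _ ⟨c', hc', rfl⟩ h
    exact hf c' hc' h
  · have : (2 : ℝ) ^ (t + 1) * (1/2) ^ (t + 1) = 1 := by
      rw [← mul_pow]; norm_num
    nlinarith
  · intro x hx
    have h := hno (fun ij => x ij.1 ij.2)
    have ho : orBlock (t + 1) f (fun ij => x ij.1 ij.2) = false := by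
      simp [orBlock, hx]
    rw [ho, abs_le] at h
    simp only [bval, Bool.false_eq_true, if_false] at h
    constructor <;> linarith [h.1, h.2]
  · rintro x ⟨i, hi⟩
    have h := hno (fun ij => x ij.1 ij.2)
    have ho : orBlock (t + 1) f (fun ij => x ij.1 ij.2) = true := by
      simp only [orBlock, decide_eq_true_eq]
      exact ⟨i, hi⟩
    rw [ho, abs_le] at h
    simp only [bval, if_true] at h
    linarith [h.1, h.2]


end
end

section
/- Let f : {-1,1}^m → {-1,1} be a Boolean function with odeg_{1/2}(f) > d, let t ≥ 1 be an integer, and let F = OR_t(f,…,f) : ({-1,1}^m)^t → {-1,1}. Then odeg_{1−2^{−t}}(F) > d; that is, no real polynomial of degree at most d on ({-1,1}^m)^t is a (1 − 2^{−t})-one-sided approximation of F. -/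
open Finset

noncomputable section

theorem exists_mid (A B : Finset ℝ) (h : ∀ a ∈ A, ∀ b ∈ B, a ≤ b) :
    ∃ y, (∀ a ∈ A, a ≤ y) ∧ (∀ b ∈ B, y ≤ b) := by
  by_cases hA : A.Nonempty
  · exact ⟨A.max' hA, fun a ha => A.le_max' a ha, fun b hb => h _ (A.max'_mem hA) b hb⟩
  · rw [Finset.not_nonempty_iff_eq_empty] at hA
    subst hA
    by_cases hB : B.Nonempty
    · exact ⟨B.min' hB, by simp, fun b hb => B.min'_le b hb⟩
    · rw [Finset.not_nonempty_iff_eq_empty] at hB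
      subst hB
      exact ⟨0, by simp, by simp⟩

/-- Fourier–Motzkin elimination (Farkas' lemma). -/
theorem farkas_aux {V : Type*} [Fintype V] [DecidableEq V] (K : Set ((V → ℝ) × ℝ))
    (hadd : ∀ a ∈ K, ∀ b ∈ K, a + b ∈ K) (hsmul : ∀ r : ℝ, 0 ≤ r → ∀ a ∈ K, r • a ∈ K)
    (hneg : ∀ a ∈ K, a.1 = 0 → 0 ≤ a.2) (U : Finset V) :
    ∀ A : Finset ((V → ℝ) × ℝ), (∀ s ∈ A, s ∈ K) → (∀ s ∈ A, ∀ v ∉ U, s.1 v = 0) →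
      ∃ x : V → ℝ, ∀ s ∈ A, s.1 ⬝ᵥ x ≤ s.2 := by
  classical
  induction U using Finset.induction_on with
  | empty =>
    intro A hA h0
    refine ⟨0, fun s hs => ?_⟩
    rw [dotProduct_zero]
    exact hneg s (hA s hs) (funext fun v => h0 s hs v (by simp))
  | insert u U hu ih =>
    intro A hA h0
    obtain ⟨x, hx⟩ := ih
      (A.filter (fun s => s.1 u = 0) ∪
        ((A.filter (fun s => 0 < s.1 u)) ×ˢ (A.filter (fun s => s.1 u < 0))).image
          (fun q => (-(q.2.1 u)) • q.1 + (q.1.1 u) • q.2)) (by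
        intro s hs
        rw [mem_union, mem_filter, mem_image] at hs
        rcases hs with hs | ⟨q, hq, rfl⟩
        · exact hA s hs.1
        · simp only [mem_product, mem_filter] at hq
          exact hadd _ (hsmul _ (by linarith [hq.2.2]) _ (hA _ hq.1.1)) _
            (hsmul _ hq.1.2.le _ (hA _ hq.2.1))) (by
        intro s hs v hv
        rw [mem_union, mem_filter, mem_image] at hs
        rcases hs with hs | ⟨q, hq, rfl⟩
        · by_cases hvu : v = u
          · subst hvu; exact hs.2
          · exact h0 s hs.1 v (by simp [hvu, hv])
        · simp only [mem_product, mem_filter] at hq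
          by_cases hvu : v = u
          · subst hvu; simp; ring
          · simp [h0 _ hq.1.1 v (by simp [hvu, hv]), h0 _ hq.2.1 v (by simp [hvu, hv])])
    obtain ⟨y, hy1, hy2⟩ := exists_mid
      ((A.filter (fun s => s.1 u < 0)).image (fun s => (s.2 - s.1 ⬝ᵥ x) / s.1 u))
      ((A.filter (fun s => 0 < s.1 u)).image (fun s => (s.2 - s.1 ⬝ᵥ x) / s.1 u)) (by
        intro a ha b hb
        simp only [mem_image, mem_filter] at ha hb
        obtain ⟨n, ⟨hn, hn0⟩, rfl⟩ := ha
        obtain ⟨p, ⟨hp, hp0⟩, rfl⟩ := hb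
        have := hx ((-(n.1 u)) • p + (p.1 u) • n) (by
          rw [mem_union]; right
          rw [mem_image]
          exact ⟨(p, n), by simp [hp, hn, hp0, hn0], rfl⟩)
        simp only [Prod.fst_add, Prod.smul_fst, Prod.snd_add, Prod.smul_snd, add_dotProduct,
          smul_dotProduct, smul_eq_mul] at this
        rw [div_le_iff_of_neg hn0, div_mul_eq_mul_div, div_le_iff₀ hp0]
        linarith)
    refine ⟨x + Pi.single u y, fun s hs => ?_⟩
    rw [dotProduct_add, dotProduct_single]
    rcases lt_trichotomy (s.1 u) 0 with h | h | h
    · have := hy1 _ (mem_image_of_mem _ (mem_filter.2 ⟨hs, h⟩))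
      rw [div_le_iff_of_neg h] at this
      linarith
    · have := hx s (mem_union_left _ (mem_filter.2 ⟨hs, h⟩))
      rw [h]; linarith
    · have := hy2 _ (mem_image_of_mem _ (mem_filter.2 ⟨hs, h⟩))
      rw [le_div_iff₀ h] at this
      linarith

theorem dual_exists (m d : ℕ) (f : (Fin m → Bool) → Bool)
    (hf : ∀ c : Finset (Fin m) → ℝ, degLE c d → ¬ IsOneSided f (polyOf c) (1/2)) :
    ∃ α β : (Fin m → Bool) → ℝ, (∀ x, 0 ≤ α x) ∧ (∀ x, 0 ≤ β x) ∧
      (∀ x, f x = true → β x = 0) ∧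
      (∀ S : Finset (Fin m), S.card ≤ d → ∑ x, α x * chi S x = ∑ x, β x * chi S x) ∧
      ∑ x, α x * (if f x then -(1/2) else 3/2) < ∑ x, β x * (1/2) := by
  classical
  by_contra hcon
  push Not at hcon
  let row : (Fin m → Bool) → Finset (Fin m) → ℝ := fun x S => if S.card ≤ d then chi S x else 0
  let K : Set ((Finset (Fin m) → ℝ) × ℝ) := {q | ∃ α β : (Fin m → Bool) → ℝ, (∀ x, 0 ≤ α x) ∧
    (∀ x, 0 ≤ β x) ∧ (∀ x, f x = true → β x = 0) ∧
    (∀ S, q.1 S = ∑ x, (α x - β x) * row x S) ∧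
    q.2 = ∑ x, (α x * (if f x then -(1/2) else 3/2) - β x * (1/2))}
  obtain ⟨c, hc⟩ := farkas_aux K
    (by
      rintro a ⟨α, β, h1, h2, h3, h4, h5⟩ b ⟨α', β', h1', h2', h3', h4', h5'⟩
      refine ⟨α + α', β + β', fun x => add_nonneg (h1 x) (h1' x),
        fun x => add_nonneg (h2 x) (h2' x), fun x hx => by simp [h3 x hx, h3' x hx], ?_, ?_⟩
      · intro S
        rw [Prod.fst_add, Pi.add_apply, h4, h4', ← sum_add_distrib]
        exact sum_congr rfl fun x _ => by simp only [Pi.add_apply]; ring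
      · rw [Prod.snd_add, h5, h5', ← sum_add_distrib]
        exact sum_congr rfl fun x _ => by simp only [Pi.add_apply]; ring)
    (by
      rintro r hr a ⟨α, β, h1, h2, h3, h4, h5⟩
      refine ⟨r • α, r • β, fun x => mul_nonneg hr (h1 x),
        fun x => mul_nonneg hr (h2 x), fun x hx => by simp [h3 x hx], ?_, ?_⟩
      · intro S
        rw [Prod.smul_fst, Pi.smul_apply, h4, smul_eq_mul, mul_sum]
        exact sum_congr rfl fun x _ => by simp only [Pi.smul_apply, smul_eq_mul]; ring
      · rw [Prod.smul_snd, h5, smul_eq_mul, mul_sum]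
        exact sum_congr rfl fun x _ => by simp only [Pi.smul_apply, smul_eq_mul]; ring)
    (by
      rintro a ⟨α, β, h1, h2, h3, h4, h5⟩ ha
      have := hcon α β h1 h2 h3 (by
        intro S hS
        have h := h4 S
        simp only [ha, Pi.zero_apply, row, if_pos hS, sub_mul, sum_sub_distrib] at h
        linarith)
      rw [h5, sum_sub_distrib]
      linarith)
    univ
    (univ.image (fun x => (row x, if f x then -(1/2) else 3/2)) ∪
      (univ.filter (fun x => f x = false)).image (fun x => (-(row x), -(1/2))))
    (by
      intro s hs
      simp only [mem_union, mem_image, mem_filter, mem_univ, true_and] at hs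
      rcases hs with ⟨x, rfl⟩ | ⟨x, hx, rfl⟩
      · refine ⟨Pi.single x 1, 0, fun z => ?_, fun z => le_rfl, fun z _ => rfl, fun S => ?_, ?_⟩
        · by_cases h : z = x
          · subst h; simp
          · simp [h]
        · simp [Pi.single_apply]
        · rw [Finset.sum_eq_single x (fun z _ hz => by simp [hz]) (by simp)]
          simp
      · refine ⟨0, Pi.single x 1, fun z => le_rfl, fun z => ?_, fun z hz => ?_, fun S => ?_, ?_⟩
        · by_cases h : z = x
          · subst h; simp
          · simp [h]
        · have : z ≠ x := by rintro rfl; simp [hx] at hz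
          simp [this]
        · simp [Pi.single_apply]
        · simp [Pi.single_apply])
    (by simp)
  refine hf (fun S => if S.card ≤ d then c S else 0) (fun S hS => if_neg (by omega)) ?_
  have key : ∀ x, polyOf (fun S => if S.card ≤ d then c S else 0) x = row x ⬝ᵥ c := by
    intro x
    simp only [polyOf, dotProduct, row]
    refine sum_congr rfl fun S _ => ?_
    split_ifs <;> ring
  have hup : ∀ x, row x ⬝ᵥ c ≤ if f x then -(1/2) else 3/2 := fun x =>
    hc (row x, if f x then -(1/2) else 3/2) (mem_union_left _ (mem_image.2 ⟨x, mem_univ _, rfl⟩))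
  refine ⟨fun x hx => ?_, fun x hx => ?_⟩
  · have h1 := hup x
    have h2 := hc (-(row x), -(1/2)) (mem_union_right _ (mem_image.2 ⟨x, by simp [hx], rfl⟩))
    simp only [neg_dotProduct] at h2
    simp only [hx, Bool.false_eq_true, if_false] at h1
    rw [key, abs_le]
    constructor <;> linarith
  · have h1 := hup x
    simp only [hx, if_true] at h1
    rw [key]; linarith

theorem chi_block {t m : ℕ} (S : Finset (Fin t × Fin m)) (y : Fin t → Fin m → Bool) :
    chi S (fun q => y q.1 q.2) = ∏ i, chi (univ.filter (fun j => (i, j) ∈ S)) (y i) := by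
  simp only [chi, prod_filter]
  rw [← Fintype.prod_prod_type' (fun i j => if (i, j) ∈ S then bval (y i j) else 1)]
  simp

theorem sum_block {t m : ℕ} (g : Fin t → (Fin m → Bool) → ℝ) :
    ∑ y : Fin t → Fin m → Bool, ∏ i, g i (y i) = ∏ i, ∑ x, g i x :=
  (Fintype.prod_sum g).symm

theorem sum_poly_block {t m : ℕ} (c : Finset (Fin t × Fin m) → ℝ) (α : (Fin m → Bool) → ℝ) :
    ∑ y : Fin t → Fin m → Bool, (∏ i, α (y i)) * polyOf c (fun q => y q.1 q.2) =
      ∑ S, c S * ∏ i, ∑ x, α x * chi (univ.filter (fun j => (i, j) ∈ S)) x := by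
  simp only [polyOf, mul_sum]
  rw [sum_comm]
  refine sum_congr rfl fun S _ => ?_
  rw [← sum_block (fun i x => α x * chi (univ.filter (fun j => (i, j) ∈ S)) x), mul_sum]
  refine sum_congr rfl fun y _ => ?_
  rw [chi_block, prod_mul_distrib]
  ring

/-- If `odeg_{1/2}(f) > d` then `odeg_{1-2^{-t}}(OR_t(f, …, f)) > d`:
no polynomial of degree at most `d` is a `(1-2^{-t})`-one-sided approximation to the
composition. -/
theorem one_sided_hardness_amplification (m d t : ℕ) (ht : 1 ≤ t)
    (f : (Fin m → Bool) → Bool)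
    (hf : ∀ c : Finset (Fin m) → ℝ, degLE c d → ¬ IsOneSided f (polyOf c) (1/2)) :
    ∀ c : Finset (Fin t × Fin m) → ℝ, degLE c d →
      ¬ IsOneSided (orBlock t f) (polyOf c) (1 - (1/2) ^ t) := by
  intro c hc ⟨hF, hT⟩
  obtain ⟨α, β, hα, hβ, hβT, hEq, hlt⟩ := dual_exists m d f hf
  have hs : ∑ x, α x = ∑ x, β x := by simpa [chi] using hEq ∅ (by simp)
  set s := ∑ x, β x with hsdef
  set w := ∑ x, α x * (if f x then 0 else 1) with hw
  have hw0 : 0 ≤ w := sum_nonneg fun x _ => mul_nonneg (hα x) (by split_ifs <;> norm_num)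
  have hws : w < s / 2 := by
    have h1 : ∑ x, α x * (if f x then -(1/2) else 3/2) = 2 * w - (1/2) * ∑ x, α x := by
      rw [hw, mul_sum, mul_sum, ← sum_sub_distrib]
      refine sum_congr rfl fun x _ => ?_
      split_ifs <;> ring
    rw [h1, ← sum_mul, hs, ← hsdef] at hlt
    linarith
  have hpow : w ^ t < (s / 2) ^ t := pow_lt_pow_left₀ hws hw0 (by omega)
  have hprod : ∑ y : Fin t → Fin m → Bool, (∏ i, α (y i)) * polyOf c (fun q => y q.1 q.2) =
      ∑ y : Fin t → Fin m → Bool, (∏ i, β (y i)) * polyOf c (fun q => y q.1 q.2) := by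
    rw [sum_poly_block, sum_poly_block]
    refine sum_congr rfl fun S _ => ?_
    by_cases hS : d < S.card
    · rw [hc S hS]; ring
    · congr 1
      refine prod_congr rfl fun i _ => hEq _ ?_
      refine le_trans ?_ (not_lt.1 hS)
      exact card_le_card_of_injOn (fun j => (i, j)) (by intro j hj; simpa using hj)
        (by intro a _ b _ h; simpa using h)
  have hlow : (1/2) ^ t * s ^ t ≤
      ∑ y : Fin t → Fin m → Bool, (∏ i, β (y i)) * polyOf c (fun q => y q.1 q.2) := by
    have h1 : s ^ t = ∑ y : Fin t → Fin m → Bool, ∏ i, β (y i) := by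
      rw [sum_block (fun _ x => β x)]; simp [hsdef]
    rw [h1, mul_sum]
    refine sum_le_sum fun y _ => ?_
    by_cases hy : ∃ i, f (y i) = true
    · obtain ⟨i, hi⟩ := hy
      rw [prod_eq_zero (mem_univ i) (hβT _ hi)]; simp
    · have h2 := hF (fun q => y q.1 q.2) (by simpa [orBlock] using hy)
      rw [abs_le] at h2
      rw [mul_comm]
      exact mul_le_mul_of_nonneg_left (by linarith [h2.1]) (prod_nonneg fun i _ => hβ _)
  have hupp : ∑ y : Fin t → Fin m → Bool, (∏ i, α (y i)) * polyOf c (fun q => y q.1 q.2) ≤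
      -((1/2) ^ t * s ^ t) + 2 * w ^ t := by
    have h1 : s ^ t = ∑ y : Fin t → Fin m → Bool, ∏ i, α (y i) := by
      rw [sum_block (fun _ x => α x), ← hs]; simp
    have h2 : w ^ t = ∑ y : Fin t → Fin m → Bool, ∏ i, (α (y i) * (if f (y i) then 0 else 1)) := by
      rw [sum_block (fun _ x => α x * (if f x then 0 else 1))]; simp [hw]
    rw [h1, h2, mul_sum, mul_sum, ← sum_neg_distrib, ← sum_add_distrib]
    refine sum_le_sum fun y _ => ?_
    have h0 : 0 ≤ ∏ i, α (y i) := prod_nonneg fun i _ => hα _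
    by_cases hy : ∃ i, f (y i) = true
    · have h3 := hT (fun q => y q.1 q.2) (by simpa [orBlock] using hy)
      obtain ⟨i, hi⟩ := hy
      rw [prod_eq_zero (f := fun i => α (y i) * (if f (y i) then 0 else 1)) (mem_univ i)
        (by simp [hi])]
      nlinarith [mul_le_mul_of_nonneg_left h3 h0]
    · have h3 := hF (fun q => y q.1 q.2) (by simpa [orBlock] using hy)
      rw [abs_le] at h3
      have h4 : ∏ i, (α (y i) * (if f (y i) then (0:ℝ) else 1)) = ∏ i, α (y i) := by
        refine prod_congr rfl fun i _ => ?_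
        rw [if_neg (fun h => hy ⟨i, h⟩), mul_one]
      rw [h4]
      nlinarith [mul_le_mul_of_nonneg_left h3.2 h0]
  have h5 : (s / 2) ^ t = (1/2) ^ t * s ^ t := by rw [← mul_pow]; congr 1; ring
  linarith

end
end

section
/- Let d ≥ 0 and t ≥ 1 be integers and let ψ : {-1,1}^m → ℝ satisfy ∑_{x∈{-1,1}^m} |ψ(x)| = 1 and ∑_{x∈{-1,1}^m} ψ(x)·χ_S(x) = 0 for every S ⊆ {1,…,m} with |S| ≤ d (in particular ∑_x ψ(x) = 0). Define Ψ : {-1,1}^t → ℝ by Ψ(1,…,1) = 1/2, Ψ(−1,…,−1) = −1/2, and Ψ(z) = 0 for all other z, and define ζ : ({-1,1}^m)^t → ℝ by ζ(x_1,…,x_t) = 2^t · Ψ(s̃gn(ψ(x_1)),…,s̃gn(ψ(x_t))) · ∏_{i=1}^t |ψ(x_i)|. Then ∑_{(x_1,…,x_t)} |ζ(x_1,…,x_t)| = 1, and ∑_{(x_1,…,x_t)} ζ(x_1,…,x_t)·χ_S(x_1,…,x_t) = 0 for every subset S of the m·t coordinates with |S| ≤ d. -/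
open Finset
open scoped Classical

noncomputable section

/-- `s̃gn(a) = -1` if `a ≤ 0` and `1` otherwise. -/
def sgnt (a : ℝ) : ℝ := if a ≤ 0 then -1 else 1

/-- The dual witness `Ψ` for `OR_t`: `Ψ(1,…,1) = 1/2`, `Ψ(-1,…,-1) = -1/2`, `Ψ(z) = 0`
otherwise. -/
def PsiOR (t : ℕ) (z : Fin t → ℝ) : ℝ :=
  if ∀ i, z i = 1 then 1/2 else if ∀ i, z i = -1 then -1/2 else 0

/-- The combined dual witness
`ζ(x_1,…,x_t) = 2^t · Ψ(s̃gn(ψ(x_1)),…,s̃gn(ψ(x_t))) · ∏_i |ψ(x_i)|`. -/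
def zeta (m t : ℕ) (ψ : (Fin m → Bool) → ℝ) (x : Fin t → Fin m → Bool) : ℝ :=
  2 ^ t * PsiOR t (fun i => sgnt (ψ (x i))) * ∏ i : Fin t, |ψ (x i)|

lemma zeta_aux (m t : ℕ) (ht : 1 ≤ t) (ψ : (Fin m → Bool) → ℝ) (x : Fin t → Fin m → Bool) :
    zeta m t ψ x = 2 ^ t * (1 / 2) * (∏ i, (|ψ (x i)| + ψ (x i)) / 2)
        - 2 ^ t * (1 / 2) * ∏ i, (|ψ (x i)| - ψ (x i)) / 2 ∧
    |zeta m t ψ x| = 2 ^ t * (1 / 2) * (∏ i, (|ψ (x i)| + ψ (x i)) / 2)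
        + 2 ^ t * (1 / 2) * ∏ i, (|ψ (x i)| - ψ (x i)) / 2 := by
  have hs1 : ∀ a : ℝ, sgnt a = 1 ↔ 0 < a := by
    intro a
    unfold sgnt
    split_ifs with h
    · constructor
      · intro h'; norm_num at h'
      · intro h'; linarith
    · simpa using h
  have hs2 : ∀ a : ℝ, sgnt a = -1 ↔ a ≤ 0 := by
    intro a
    unfold sgnt
    split_ifs with h
    · simpa using h
    · constructor
      · intro h'; norm_num at h'
      · intro h'; exact absurd h' h
  have hp0 : ∀ i, ψ (x i) ≤ 0 → ∏ i, (|ψ (x i)| + ψ (x i)) / 2 = 0 := by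
    intro i hi
    apply Finset.prod_eq_zero (Finset.mem_univ i)
    rw [abs_of_nonpos hi]; ring
  have hq0 : ∀ i, 0 < ψ (x i) → ∏ i, (|ψ (x i)| - ψ (x i)) / 2 = 0 := by
    intro i hi
    apply Finset.prod_eq_zero (Finset.mem_univ i)
    rw [abs_of_pos hi]; ring
  have hnn : (0 : ℝ) ≤ ∏ i, |ψ (x i)| := Finset.prod_nonneg fun i _ => abs_nonneg _
  have h2 : (0 : ℝ) < 2 ^ t := by positivity
  unfold zeta PsiOR
  simp only [hs1, hs2]
  split_ifs with h h'
  · rw [hq0 ⟨0, ht⟩ (h _)]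
    have : ∏ i, (|ψ (x i)| + ψ (x i)) / 2 = ∏ i, |ψ (x i)| :=
      Finset.prod_congr rfl fun i _ => by rw [abs_of_pos (h i)]; ring
    rw [this, abs_of_nonneg (by positivity)]
    constructor <;> ring
  · rw [hp0 ⟨0, ht⟩ (h' _)]
    have : ∏ i, (|ψ (x i)| - ψ (x i)) / 2 = ∏ i, |ψ (x i)| :=
      Finset.prod_congr rfl fun i _ => by rw [abs_of_nonpos (h' i)]; ring
    rw [this, abs_mul, abs_mul, abs_of_nonneg hnn, abs_of_pos h2]
    norm_num
  · push Not at h h'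
    obtain ⟨i, hi⟩ := h
    obtain ⟨j, hj⟩ := h'
    rw [hp0 i hi, hq0 j hj]
    simp

lemma chi_fiber (m t : ℕ) (S : Finset (Fin t × Fin m)) (x : Fin t → Fin m → Bool) :
    chi S (fun p => x p.1 p.2) =
      ∏ i, chi (Finset.univ.filter fun j => (i, j) ∈ S) (x i) := by
  unfold chi
  simp only [Finset.prod_filter]
  rw [← Fintype.prod_prod_type' (f := fun i j => if (i, j) ∈ S then bval (x i j) else 1)]
  simp

lemma sum_prod_aux (m t : ℕ) (f : Fin t → (Fin m → Bool) → ℝ) :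
    ∑ x : Fin t → Fin m → Bool, ∏ i, f i (x i) = ∏ i, ∑ y, f i y :=
  (Fintype.prod_sum f).symm

/-- if `ψ` has unit `ℓ₁`-norm and pure high degree `d`, then the combined
dual witness `ζ` has unit `ℓ₁`-norm and pure high degree `d`. -/
theorem combined_dual_witness (m d t : ℕ) (ht : 1 ≤ t)
    (ψ : (Fin m → Bool) → ℝ)
    (hnorm : ∑ x : Fin m → Bool, |ψ x| = 1)
    (hphd : ∀ S : Finset (Fin m), S.card ≤ d → ∑ x : Fin m → Bool, ψ x * chi S x = 0) :
    (∑ x : Fin t → Fin m → Bool, |zeta m t ψ x| = 1) ∧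
    (∀ S : Finset (Fin t × Fin m), S.card ≤ d →
      ∑ x : Fin t → Fin m → Bool, zeta m t ψ x * chi S (fun p => x p.1 p.2) = 0) := by
  constructor
  · have h0 : ∑ x, ψ x = 0 := by simpa [chi] using hphd ∅ (by simp)
    simp only [(zeta_aux m t ht ψ _).2, Finset.sum_add_distrib, ← Finset.mul_sum]
    rw [sum_prod_aux m t (fun _ y => (|ψ y| + ψ y) / 2),
      sum_prod_aux m t (fun _ y => (|ψ y| - ψ y) / 2)]
    simp only [← Finset.sum_div, Finset.sum_add_distrib, Finset.sum_sub_distrib, hnorm, h0]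
    simp
    ring_nf
    rw [← mul_pow]; norm_num
  · intro S hS
    simp only [(zeta_aux m t ht ψ _).1, chi_fiber, sub_mul, Finset.sum_sub_distrib, mul_assoc,
      ← Finset.mul_sum, ← Finset.prod_mul_distrib]
    rw [sum_prod_aux m t (fun i y => (|ψ y| + ψ y) / 2 *
        chi (Finset.univ.filter fun j => (i, j) ∈ S) y),
      sum_prod_aux m t (fun i y => (|ψ y| - ψ y) / 2 *
        chi (Finset.univ.filter fun j => (i, j) ∈ S) y), sub_eq_zero]
    congr 2
    apply Finset.prod_congr rfl
    intro i _
    rw [← sub_eq_zero, ← Finset.sum_sub_distrib]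
    rw [← hphd (Finset.univ.filter fun j => (i, j) ∈ S) ?_]
    · apply Finset.sum_congr rfl
      intro y _
      ring
    · refine le_trans ?_ hS
      apply Finset.card_le_card_of_injOn (fun j => (i, j))
      · intro j hj
        simpa using hj
      · intro a _ b _ hab
        simpa using hab

end
end

section
/- Let N ≤ R with R a power of 2, m = N·log₂R, and let f : {-1,1}^m → {-1,1} compute a symmetric property of the associated functions g_x : {1,…,N} → {1,…,R}. Suppose moreover that for every pair x, y ∈ f^{-1}(−1) there exist a permutation σ of {1,…,R} and a permutation π of {1,…,N} with g_x = σ∘g_y∘π. Then odeg_ε(f) ≥ deg̃_ε(f)/log₂R for every ε > 0. -/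
open Finset

noncomputable section

/-- `p` is a pointwise `ε`-approximation to the Boolean function `f`. -/
def IsApprox {ι : Type*} (f : (ι → Bool) → Bool) (p : (ι → Bool) → ℝ) (ε : ℝ) : Prop :=
  ∀ x, |p x - bval (f x)| ≤ ε

/-- The `ε`-approximate degree `deg̃_ε(f)`. -/
def adeg {ι : Type*} [Fintype ι] (ε : ℝ) (f : (ι → Bool) → Bool) : ℕ :=
  sInf {d | ∃ c : Finset ι → ℝ, degLE c d ∧ IsApprox f (polyOf c) ε}

/-- The one-sided `ε`-approximate degree `odeg_ε(f)`. -/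
def odeg {ι : Type*} [Fintype ι] (ε : ℝ) (f : (ι → Bool) → Bool) : ℕ :=
  sInf {d | ∃ c : Finset ι → ℝ, degLE c d ∧ IsOneSided f (polyOf c) ε}

/-- Read an input `x ∈ {-1,1}^{N·k}` (indexed as `N` blocks of `k` bits) as a function
`g_x : [N] → [2^k]`, each block giving the binary representation of its value. -/
def gOf {N k : ℕ} (x : Fin N × Fin k → Bool) (i : Fin N) : Fin (2 ^ k) :=
  finFunctionFinEquiv (fun j => if x (i, j) then 1 else 0)

/-- Real functions on the cube of degree at most `D`. -/
def degSub (ι : Type*) [Fintype ι] (D : ℕ) : Submodule ℝ ((ι → Bool) → ℝ) where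
  carrier := {h | ∃ c : Finset ι → ℝ, degLE c D ∧ polyOf c = h}
  zero_mem' := ⟨fun _ => 0, fun _ _ => rfl, by funext x; simp [polyOf]⟩
  add_mem' := by
    rintro a b ⟨c, hc, rfl⟩ ⟨c', hc', rfl⟩
    refine ⟨fun S => c S + c' S, fun S hS => by simp [hc S hS, hc' S hS], ?_⟩
    funext x
    simp [polyOf, add_mul, Finset.sum_add_distrib]
  smul_mem' := by
    rintro r a ⟨c, hc, rfl⟩
    refine ⟨fun S => r * c S, fun S hS => by simp [hc S hS], ?_⟩
    funext x
    simp [polyOf, mul_assoc, Finset.mul_sum]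

theorem chi_mem_degSub {ι : Type*} [Fintype ι] {D : ℕ} (S : Finset ι) (hS : S.card ≤ D) :
    (fun x => chi S x) ∈ degSub ι D := by
  classical
  refine ⟨fun T => if T = S then 1 else 0, fun T hT => ?_, ?_⟩
  · refine if_neg ?_
    rintro rfl
    omega
  · funext x
    simp [polyOf]

theorem junta_mem_degSub {ι : Type*} [Fintype ι] {D : ℕ} (U : Finset ι) (hU : U.card ≤ D)
    (h : (ι → Bool) → ℝ) (hh : ∀ x y, (∀ i ∈ U, x i = y i) → h x = h y) :
    h ∈ degSub ι D := by
  classical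
  have key : h = ∑ A ∈ U.powerset, h (fun i => decide (i ∈ A)) •
      ∑ T ∈ U.powerset, ((∏ i ∈ T, bval (decide (i ∈ A)) / 2) * (∏ i ∈ U \ T, (1 / 2 : ℝ))) •
        (fun x => chi T x) := by
    funext x
    have e : ∀ A : Finset ι, ∑ T ∈ U.powerset, ((∏ i ∈ T, bval (decide (i ∈ A)) / 2) *
        (∏ i ∈ U \ T, (1 / 2 : ℝ))) * chi T x =
        ∏ i ∈ U, (bval (decide (i ∈ A)) / 2 * bval (x i) + 1 / 2) := by
      intro A
      rw [Finset.prod_add]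
      refine Finset.sum_congr rfl fun T _ => ?_
      rw [Finset.prod_mul_distrib, chi]
      ring
    simp only [Finset.sum_apply, Pi.smul_apply, smul_eq_mul]
    simp only [e]
    rw [Finset.sum_eq_single (U.filter fun i => x i = true)]
    · rw [Finset.prod_eq_one, mul_one]
      · apply hh
        intro i hi
        simp [hi]
      · intro i hi
        cases hx : x i <;> simp [hi, hx, bval] <;> norm_num
    · intro A hA hne
      rw [Finset.mem_powerset] at hA
      have : ∃ i ∈ U, x i ≠ decide (i ∈ A) := by
        by_contra hcon
        push Not at hcon
        apply hne
        ext i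
        simp only [Finset.mem_filter]
        constructor
        · intro hi
          exact ⟨hA hi, by rw [hcon i (hA hi)]; simpa using hi⟩
        · rintro ⟨hi, hx⟩
          rw [hcon i hi] at hx
          simpa using hx
      obtain ⟨i, hi, hx⟩ := this
      rw [Finset.prod_eq_zero hi, mul_zero]
      cases h1 : x i <;> cases h2 : decide (i ∈ A) <;> simp_all [bval] <;> norm_num
    · intro hn
      exact absurd (Finset.mem_powerset.2 (Finset.filter_subset _ _)) hn
  rw [key]
  refine Submodule.sum_mem _ fun A _ => Submodule.smul_mem _ _ <|
    Submodule.sum_mem _ fun T hT => Submodule.smul_mem _ _ <| chi_mem_degSub T ?_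
  exact (Finset.card_le_card (Finset.mem_powerset.1 hT)).trans hU

/-- The input encoding a given function. -/
def decIn {N k : ℕ} (g : Fin N → Fin (2 ^ k)) : Fin N × Fin k → Bool :=
  fun ij => decide (finFunctionFinEquiv.symm (g ij.1) ij.2 = (1 : Fin 2))

theorem gOf_decIn {N k : ℕ} (g : Fin N → Fin (2 ^ k)) : gOf (decIn g) = g := by
  funext i
  rw [gOf, ← Equiv.eq_symm_apply]
  funext j
  simp only [decIn, decide_eq_true_eq]
  generalize finFunctionFinEquiv.symm (g i) j = a
  revert a
  decide

/-- The symmetrization of `p`. -/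
def symAvg {N k : ℕ} (p : (Fin N × Fin k → Bool) → ℝ) : (Fin N × Fin k → Bool) → ℝ :=
  fun x => ((Fintype.card (Equiv.Perm (Fin (2 ^ k)) × Equiv.Perm (Fin N)) : ℝ))⁻¹ *
    ∑ s : Equiv.Perm (Fin (2 ^ k)) × Equiv.Perm (Fin N), p (decIn (⇑s.1 ∘ gOf x ∘ ⇑s.2))

theorem symAvg_mem {N k d : ℕ} (c : Finset (Fin N × Fin k) → ℝ) (hc : degLE c d) :
    symAvg (polyOf c) ∈ degSub (Fin N × Fin k) (d * k) := by
  have e : symAvg (polyOf c) =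
      ((Fintype.card (Equiv.Perm (Fin (2 ^ k)) × Equiv.Perm (Fin N)) : ℝ))⁻¹ •
      ∑ s : Equiv.Perm (Fin (2 ^ k)) × Equiv.Perm (Fin N), ∑ S : Finset (Fin N × Fin k),
        c S • (fun x => chi S (decIn (⇑s.1 ∘ gOf x ∘ ⇑s.2))) := by
    funext x
    simp [symAvg, polyOf, Finset.sum_apply]
  rw [e]
  refine Submodule.smul_mem _ _ <| Submodule.sum_mem _ fun s _ => Submodule.sum_mem _ fun S _ => ?_
  by_cases hS : d < S.card
  · rw [hc S hS, zero_smul]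
    exact Submodule.zero_mem _
  refine Submodule.smul_mem _ _ ?_
  refine junta_mem_degSub ((S.image fun ij => s.2 ij.1) ×ˢ Finset.univ) ?_ _ ?_
  · rw [Finset.card_product, Finset.card_univ, Fintype.card_fin]
    exact Nat.mul_le_mul_right _ (Finset.card_image_le.trans (not_lt.1 hS))
  · intro x y hxy
    refine Finset.prod_congr rfl fun ij hij => ?_
    have : gOf x (s.2 ij.1) = gOf y (s.2 ij.1) := by
      unfold gOf
      congr 1
      funext j
      rw [hxy (s.2 ij.1, j)]
      rw [Finset.mem_product]
      exact ⟨Finset.mem_image_of_mem _ hij, Finset.mem_univ _⟩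
    simp [decIn, this]

theorem symAvg_congr {N k : ℕ} (p : (Fin N × Fin k → Bool) → ℝ) (x y : Fin N × Fin k → Bool)
    (σ : Equiv.Perm (Fin (2 ^ k))) (π : Equiv.Perm (Fin N)) (h : gOf x = ⇑σ ∘ gOf y ∘ ⇑π) :
    symAvg p x = symAvg p y := by
  unfold symAvg
  congr 1
  refine Fintype.sum_equiv ((Equiv.mulRight σ).prodCongr (Equiv.mulLeft π)) _ _ fun s => ?_
  rw [h]
  rfl

theorem symAvg_le {N k : ℕ} (p : (Fin N × Fin k → Bool) → ℝ) (x : Fin N × Fin k → Bool) (b : ℝ)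
    (h : ∀ s : Equiv.Perm (Fin (2 ^ k)) × Equiv.Perm (Fin N),
      p (decIn (⇑s.1 ∘ gOf x ∘ ⇑s.2)) ≤ b) : symAvg p x ≤ b := by
  unfold symAvg
  rw [inv_mul_le_iff₀ (by exact_mod_cast Fintype.card_pos)]
  refine (Finset.sum_le_card_nsmul _ _ b fun s _ => h s).trans_eq ?_
  rw [nsmul_eq_mul, Finset.card_univ]

theorem le_symAvg {N k : ℕ} (p : (Fin N × Fin k → Bool) → ℝ) (x : Fin N × Fin k → Bool) (b : ℝ)
    (h : ∀ s : Equiv.Perm (Fin (2 ^ k)) × Equiv.Perm (Fin N),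
      b ≤ p (decIn (⇑s.1 ∘ gOf x ∘ ⇑s.2))) : b ≤ symAvg p x := by
  unfold symAvg
  rw [le_inv_mul_iff₀ (by exact_mod_cast Fintype.card_pos)]
  refine Eq.trans_le ?_ (Finset.card_nsmul_le_sum _ _ b fun s _ => h s)
  rw [nsmul_eq_mul, Finset.card_univ]

/-- if `f` computes a symmetric property of the functions
`g_x : [N] → [R]` (`R = 2^k`, `N ≤ R`) and all inputs in `f⁻¹(-1)` are equivalent up to
permutations of domain and range, then `odeg_ε(f) ≥ deg̃_ε(f) / log₂ R` for every `ε > 0`. -/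
theorem symmetric_property_odeg (N k : ℕ) (hNR : N ≤ 2 ^ k)
    (f : (Fin N × Fin k → Bool) → Bool)
    (hsym : ∀ x y : Fin N × Fin k → Bool,
      (∃ σ : Equiv.Perm (Fin (2 ^ k)), ∃ π : Equiv.Perm (Fin N),
        gOf y = ⇑σ ∘ gOf x ∘ ⇑π) → f y = f x)
    (htrue : ∀ x y : Fin N × Fin k → Bool, f x = true → f y = true →
      ∃ σ : Equiv.Perm (Fin (2 ^ k)), ∃ π : Equiv.Perm (Fin N),
        gOf x = ⇑σ ∘ gOf y ∘ ⇑π)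
    (ε : ℝ) (hε : 0 < ε) :
    (adeg ε f : ℝ) / (k : ℝ) ≤ (odeg ε f : ℝ) := by
  have hne : {d | ∃ c : Finset (Fin N × Fin k) → ℝ,
      degLE c d ∧ IsOneSided f (polyOf c) ε}.Nonempty := by
    obtain ⟨c, hc, hcf⟩ := junta_mem_degSub (Finset.univ : Finset (Fin N × Fin k)) le_rfl
      (fun x => bval (f x)) (fun x y h => by
        have : x = y := funext fun i => h i (Finset.mem_univ i)
        rw [this])
    refine ⟨_, c, hc, ?_, ?_⟩
    · intro x hx
      rw [hcf]
      simp [hx, bval, hε.le]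
    · intro x hx
      rw [hcf]
      simp [hx, bval, hε.le]
  obtain ⟨c, hc, h1, h2⟩ := Nat.sInf_mem hne
  change degLE c (odeg ε f) at hc
  set q := symAvg (polyOf c) with hq
  have hqm := symAvg_mem c hc
  have hf : ∀ x (s : Equiv.Perm (Fin (2 ^ k)) × Equiv.Perm (Fin N)),
      f (decIn (⇑s.1 ∘ gOf x ∘ ⇑s.2)) = f x := fun x s =>
    hsym _ _ ⟨s.1, s.2, gOf_decIn _⟩
  have q1 : ∀ x, f x = false → |q x - 1| ≤ ε := by
    intro x hx
    rw [abs_le]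
    constructor
    · have := le_symAvg (polyOf c) x (1 - ε) fun s => by
        have := (abs_le.1 (h1 _ ((hf x s).trans hx))).1
        linarith
      linarith
    · have := symAvg_le (polyOf c) x (1 + ε) fun s => by
        have := (abs_le.1 (h1 _ ((hf x s).trans hx))).2
        linarith
      linarith
  have q2 : ∀ x, f x = true → q x ≤ -1 + ε := fun x hx =>
    symAvg_le (polyOf c) x _ fun s => h2 _ ((hf x s).trans hx)
  have main : ∃ r ∈ degSub (Fin N × Fin k) (odeg ε f * k), IsApprox f r ε := by
    by_cases hex : ∃ x, f x = true ∧ q x < -1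
    · obtain ⟨x0, hx0, hlt⟩ := hex
      have hconst : ∀ x, f x = true → q x = q x0 := fun x hx => by
        obtain ⟨σ, π, h⟩ := htrue x x0 hx hx0
        exact symAvg_congr _ _ _ σ π h
      set a : ℝ := 2 / (1 - q x0) with ha
      have hpos : 0 < 1 - q x0 := by linarith
      have ha0 : 0 ≤ a := by positivity
      have ha1 : a ≤ 1 := by
        rw [ha, div_le_one hpos]
        linarith
      refine ⟨a • q + fun _ => 1 - a, Submodule.add_mem _ (Submodule.smul_mem _ _ hqm)
        (junta_mem_degSub ∅ (by simp) _ fun _ _ _ => rfl), fun x => ?_⟩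
      simp only [Pi.add_apply, Pi.smul_apply, smul_eq_mul]
      cases hx : f x
      · have e : a * q x + (1 - a) - bval false = a * (q x - 1) := by
          simp [bval]
          ring
        rw [e, abs_mul, abs_of_nonneg ha0]
        exact (mul_le_of_le_one_left (abs_nonneg _) ha1).trans (q1 x hx)
      · have e : a * q x + (1 - a) - bval true = 0 := by
          rw [hconst x hx]
          have : a * (1 - q x0) = 2 := by
            rw [ha]
            field_simp
          simp only [bval, if_true]
          linarith
        rw [e, abs_zero]
        exact hε.le
    · push Not at hex
      refine ⟨q, hqm, fun x => ?_⟩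
      cases hx : f x
      · simpa [bval] using q1 x hx
      · have u := q2 x hx
        have v := hex x hx
        simp only [bval, if_true]
        rw [abs_le]
        constructor <;> linarith
  obtain ⟨r, ⟨c', hc', rfl⟩, hr⟩ := main
  have hle : adeg ε f ≤ odeg ε f * k := Nat.sInf_le ⟨c', hc', hr⟩
  rcases Nat.eq_zero_or_pos k with hk | hk
  · have : (k : ℝ) = 0 := by exact_mod_cast hk
    rw [this, div_zero]
    exact Nat.cast_nonneg _
  · rw [div_le_iff₀ (by exact_mod_cast hk)]
    exact_mod_cast hle

end
end

section
/- Let R be a power of 2, N ≤ R, and m = N·log₂R. For x, y ∈ {-1,1}^m write y ∼ x if there exist a permutation σ of {1,…,R} and a permutation π of {1,…,N} such that g_y = σ∘g_x∘π. Let p : {-1,1}^m → ℝ be a real polynomial, and define p^sym(x) = E_{y∼x}[p(y)], the average of p(y) over all y obtained from x by a uniformly random pair of such permutations (σ, π). Then deg(p^sym) ≤ (log₂R)·deg(p). -/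
open Finset

noncomputable section

/-- The degree of a function on the Boolean cube: the degree of its (unique) multilinear
representation, expressed as the least `d` such that it is represented by a polynomial of
degree at most `d`. -/
def funDeg {ι : Type*} [Fintype ι] (p : (ι → Bool) → ℝ) : ℕ :=
  sInf {d | ∃ c : Finset ι → ℝ, degLE c d ∧ ∀ x, p x = polyOf c x}

/-- The action of a pair of permutations `(σ, π)` on inputs: `act σ π x` is the unique
input `y` with `g_y = σ ∘ g_x ∘ π` (block `i` of `y` encodes `σ(g_x(π(i)))` in binary). -/
def act {N k : ℕ} (σ : Equiv.Perm (Fin (2 ^ k))) (π : Equiv.Perm (Fin N))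
    (x : Fin N × Fin k → Bool) : Fin N × Fin k → Bool :=
  fun p => decide (finFunctionFinEquiv.symm (σ (gOf x (π p.1))) p.2 = 1)

/-- The symmetrization `p^sym(x) = E_{σ,π}[p(y)]` where `g_y = σ ∘ g_x ∘ π` for uniformly
random permutations `σ` of the range and `π` of the domain. -/
def psym {N k : ℕ} (p : (Fin N × Fin k → Bool) → ℝ) (x : Fin N × Fin k → Bool) : ℝ :=
  (∑ σ : Equiv.Perm (Fin (2 ^ k)), ∑ π : Equiv.Perm (Fin N), p (act σ π x)) /
    ((Fintype.card (Equiv.Perm (Fin (2 ^ k))) : ℝ) * (Fintype.card (Equiv.Perm (Fin N)) : ℝ))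

/-- The space of functions represented by a polynomial of degree at most `d`. -/
def degSpace (ι : Type*) [Fintype ι] (d : ℕ) : Submodule ℝ ((ι → Bool) → ℝ) where
  carrier := {f | ∃ c : Finset ι → ℝ, degLE c d ∧ ∀ x, f x = polyOf c x}
  add_mem' := by
    rintro f g ⟨c, hc, hf⟩ ⟨e, he, hg⟩
    refine ⟨c + e, fun S hS => by simp [hc S hS, he S hS], fun x => ?_⟩
    simp only [Pi.add_apply, hf, hg, polyOf, add_mul, Finset.sum_add_distrib]
  zero_mem' := ⟨0, fun S _ => rfl, fun x => by simp [polyOf]⟩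
  smul_mem' := by
    rintro a f ⟨c, hc, hf⟩
    refine ⟨a • c, fun S hS => by simp [hc S hS], fun x => ?_⟩
    simp only [Pi.smul_apply, hf, polyOf, smul_eq_mul, Finset.mul_sum, mul_assoc]

lemma chi_mem_degSpace {ι : Type*} [Fintype ι] (S : Finset ι) (d : ℕ) (h : S.card ≤ d) :
    chi S ∈ degSpace ι d := by
  classical
  refine ⟨fun T => if T = S then 1 else 0, fun T hT => ?_, fun x => ?_⟩
  · have : T ≠ S := by rintro rfl; omega
    simp [this]
  · simp [polyOf]

/-- The span of the characters supported inside `T`. -/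
def juntaSpace {ι : Type*} (T : Finset ι) : Submodule ℝ ((ι → Bool) → ℝ) :=
  Submodule.span ℝ {f | ∃ S : Finset ι, S ⊆ T ∧ f = chi S}

lemma juntaSpace_mono {ι : Type*} {T U : Finset ι} (h : T ⊆ U) :
    juntaSpace T ≤ juntaSpace U := by
  apply Submodule.span_mono
  rintro f ⟨S, hS, rfl⟩
  exact ⟨S, hS.trans h, rfl⟩

lemma juntaSpace_le {ι : Type*} [Fintype ι] (T : Finset ι) (d : ℕ) (h : T.card ≤ d) :
    juntaSpace T ≤ degSpace ι d := by
  apply Submodule.span_le.2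
  rintro f ⟨S, hS, rfl⟩
  exact chi_mem_degSpace S d ((Finset.card_le_card hS).trans h)

lemma bval_mul_mem {ι : Type*} [DecidableEq ι] {T : Finset ι} {i : ι} (hi : i ∉ T)
    {f : (ι → Bool) → ℝ} (hf : f ∈ juntaSpace T) :
    (fun x => bval (x i) * f x) ∈ juntaSpace (insert i T) := by
  induction hf using Submodule.span_induction with
  | mem f hf =>
    obtain ⟨S, hS, rfl⟩ := hf
    refine Submodule.subset_span ⟨insert i S, Finset.insert_subset_insert i hS, ?_⟩
    funext x
    rw [chi, chi, Finset.prod_insert (fun h => hi (hS h))]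
  | zero =>
    convert (juntaSpace (insert i T)).zero_mem using 1
    funext x; simp
  | add f g _ _ hf hg =>
    convert (juntaSpace (insert i T)).add_mem hf hg using 1
    funext x; simp [mul_add]
  | smul a f _ hf =>
    convert (juntaSpace (insert i T)).smul_mem a hf using 1
    funext x; simp; ring

lemma junta_mem {ι : Type*} [DecidableEq ι] (T : Finset ι) :
    ∀ f : (ι → Bool) → ℝ, (∀ x y, (∀ i ∈ T, x i = y i) → f x = f y) → f ∈ juntaSpace T := by
  induction T using Finset.induction_on with
  | empty =>
    intro f hf
    have : f = f (fun _ => false) • chi (∅ : Finset ι) := by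
      funext x
      simp [chi, hf x (fun _ => false)]
    rw [this]
    exact Submodule.smul_mem _ _ (Submodule.subset_span ⟨∅, subset_rfl, rfl⟩)
  | insert i T hi ih =>
    intro f hf
    have key : ∀ b, (fun x => f (Function.update x i b)) ∈ juntaSpace T := by
      intro b
      apply ih
      intro x y hxy
      apply hf
      intro j hj
      by_cases hji : j = i
      · subst hji; simp
      · simp [hji, hxy j (Finset.mem_of_mem_insert_of_ne hj hji)]
    have hsub := juntaSpace_mono (Finset.subset_insert i T)
    have h0 := key false
    have h1 := key true
    have := Submodule.smul_mem _ (1/2 : ℝ) (Submodule.add_mem _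
      (Submodule.add_mem _ (hsub h0) (hsub h1))
      (Submodule.sub_mem _ (bval_mul_mem hi h0) (bval_mul_mem hi h1)))
    convert this using 1
    funext x
    simp only [Pi.smul_apply, Pi.add_apply, Pi.sub_apply, smul_eq_mul]
    have hx : f (Function.update x i (x i)) = f x := by simp
    rw [← hx]
    cases x i <;> simp [bval] <;> ring

lemma funDeg_spec {ι : Type*} [Fintype ι] (p : (ι → Bool) → ℝ) : p ∈ degSpace ι (funDeg p) := by
  classical
  have hne : {d | ∃ c : Finset ι → ℝ, degLE c d ∧ ∀ x, p x = polyOf c x}.Nonempty := by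
    refine ⟨(Finset.univ : Finset ι).card, ?_⟩
    refine juntaSpace_le Finset.univ _ le_rfl (junta_mem _ p ?_)
    intro x y h
    rw [funext fun i => h i (Finset.mem_univ i)]
  exact Nat.sInf_mem hne

lemma chi_act_mem {N k : ℕ} (σ : Equiv.Perm (Fin (2 ^ k))) (π : Equiv.Perm (Fin N))
    (S : Finset (Fin N × Fin k)) (d : ℕ) (hS : S.card ≤ d) :
    (fun x => chi S (act σ π x)) ∈ degSpace (Fin N × Fin k) (k * d) := by
  have hc : ((S.image fun q => π q.1) ×ˢ (Finset.univ : Finset (Fin k))).card ≤ k * d := by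
    rw [Finset.card_product, Finset.card_univ, Fintype.card_fin, mul_comm]
    exact Nat.mul_le_mul_left k (Finset.card_image_le.trans hS)
  refine juntaSpace_le _ _ hc (junta_mem _ _ ?_)
  intro x y h
  refine Finset.prod_congr rfl fun q hq => ?_
  have hg : gOf x (π q.1) = gOf y (π q.1) := by
    unfold gOf
    congr 1
    funext j
    rw [h (π q.1, j) (Finset.mem_product.2
      ⟨Finset.mem_image_of_mem (fun q => π q.1) hq, Finset.mem_univ j⟩)]
  simp only [act, hg]

lemma act_mem {N k : ℕ} (σ : Equiv.Perm (Fin (2 ^ k))) (π : Equiv.Perm (Fin N))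
    (p : (Fin N × Fin k → Bool) → ℝ) :
    (fun x => p (act σ π x)) ∈ degSpace (Fin N × Fin k) (k * funDeg p) := by
  obtain ⟨c, hc, hp⟩ := funDeg_spec p
  have : (fun x => p (act σ π x)) = ∑ S, c S • (fun x => chi S (act σ π x)) := by
    funext x
    simp [hp, polyOf]
  rw [this]
  refine Submodule.sum_mem _ fun S _ => ?_
  by_cases h : S.card ≤ funDeg p
  · exact Submodule.smul_mem _ _ (chi_act_mem σ π S _ h)
  · rw [hc S (not_le.1 h), zero_smul]
    exact Submodule.zero_mem _

/-- symmetrization increases the degree by a factor of at most `log₂ R`. -/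
theorem psym_degree (N k : ℕ) (hNR : N ≤ 2 ^ k)
    (p : (Fin N × Fin k → Bool) → ℝ) :
    funDeg (psym p) ≤ k * funDeg p := by
  apply Nat.sInf_le
  change psym p ∈ degSpace (Fin N × Fin k) (k * funDeg p)
  have : psym p = ((Fintype.card (Equiv.Perm (Fin (2 ^ k))) : ℝ) *
      (Fintype.card (Equiv.Perm (Fin N)) : ℝ))⁻¹ •
      ∑ σ : Equiv.Perm (Fin (2 ^ k)), ∑ π : Equiv.Perm (Fin N), fun x => p (act σ π x) := by
    funext x
    simp only [psym, Pi.smul_apply, Finset.sum_apply, smul_eq_mul]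
    rw [div_eq_inv_mul]
  rw [this]
  exact Submodule.smul_mem _ _ (Submodule.sum_mem _ fun σ _ =>
    Submodule.sum_mem _ fun π _ => act_mem σ π p)

end
end

section
/- Let f : {-1,1}^n → {-1,1} be a Boolean function, ε > 0, and d ≥ 0 an integer. Then odeg_ε(f) > d if and only if there exists a function φ : {-1,1}^n → ℝ satisfying: (i) ∑_{x∈{-1,1}^n} f(x)·φ(x) > ε; (ii) ∑_{x∈{-1,1}^n} |φ(x)| = 1; (iii) ∑_{x∈{-1,1}^n} φ(x)·χ_S(x) = 0 for every S ⊆ {1,…,n} with |S| ≤ d; and (iv) φ(x) ≤ 0 for every x with f(x) = −1. -/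
open Finset

noncomputable section

/-- One step of Fourier-Motzkin: a scalar between lower and upper bounds. -/
theorem fm_scalar {I : Type} [Fintype I] (w r : I → ℝ)
    (hz : ∀ i, w i = 0 → 0 ≤ r i)
    (hpn : ∀ p m, 0 < w p → w m < 0 → 0 ≤ (-w m) * r p + w p * r m) :
    ∃ t : ℝ, ∀ i, t * w i ≤ r i := by
  classical
  have key : ∃ t : ℝ, (∀ m, w m < 0 → r m / w m ≤ t) ∧ (∀ p, 0 < w p → t ≤ r p / w p) := by
    by_cases hN : ∃ m, w m < 0
    · have hne : (univ.filter (fun m => w m < 0)).Nonempty := by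
        obtain ⟨m, hm⟩ := hN
        exact ⟨m, by simpa using hm⟩
      obtain ⟨m, hm, hmax⟩ := Finset.exists_max_image _ (fun m => r m / w m) hne
      simp only [mem_filter, mem_univ, true_and] at hm hmax
      refine ⟨r m / w m, hmax, fun p hp => ?_⟩
      have h := hpn p m hp hm
      rw [le_div_iff₀ hp, div_mul_eq_mul_div, div_le_iff_of_neg hm]
      linarith
    · by_cases hP : ∃ p, 0 < w p
      · have hne : (univ.filter (fun m => 0 < w m)).Nonempty := by
          obtain ⟨m, hm⟩ := hP
          exact ⟨m, by simpa using hm⟩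
        obtain ⟨m, hm, hmin⟩ := Finset.exists_min_image _ (fun m => r m / w m) hne
        simp only [mem_filter, mem_univ, true_and] at hm hmin
        exact ⟨r m / w m, fun m hm => (hN ⟨m, hm⟩).elim, hmin⟩
      · exact ⟨0, fun m hm => (hN ⟨m, hm⟩).elim, fun m hm => (hP ⟨m, hm⟩).elim⟩
  obtain ⟨t, h1, h2⟩ := key
  refine ⟨t, fun i => ?_⟩
  rcases lt_trichotomy (w i) 0 with h | h | h
  · have := h1 i h
    rwa [div_le_iff_of_neg h] at this
  · simpa [h] using hz i h
  · have := h2 i h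
    rwa [le_div_iff₀ h] at this

/-- Farkas' lemma (affine form). -/
theorem farkas_fin (k : ℕ) : ∀ (I : Type) [Fintype I] (u : Fin k → I → ℝ) (b : I → ℝ),
    (¬ ∃ c : Fin k → ℝ, ∀ i, ∑ j, c j * u j i ≤ b i) →
    ∃ l : I → ℝ, (∀ i, 0 ≤ l i) ∧ (∀ j, ∑ i, l i * u j i = 0) ∧ ∑ i, l i * b i < 0 := by
  classical
  induction k with
  | zero =>
    intro I _ u b h
    push Not at h
    obtain ⟨i, hi⟩ := h 0
    refine ⟨fun i' => if i' = i then 1 else 0, fun i' => by dsimp only; split_ifs <;> norm_num,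
      fun j => j.elim0, ?_⟩
    simpa using hi
  | succ k ih =>
    intro I _ u b h
    let w := u 0
    let mu : I ⊕ I × I → I → ℝ := fun J => match J with
      | Sum.inl i => if w i = 0 then Pi.single i 1 else 0
      | Sum.inr (p, m) => if 0 < w p ∧ w m < 0 then
          Pi.single p (-w m) + Pi.single m (w p) else 0
    have mu_nonneg : ∀ J i, 0 ≤ mu J i := by
      rintro (i | ⟨p, m⟩) i'
      · simp only [mu]
        split_ifs
        · simp only [Pi.single_apply]; split_ifs <;> norm_num
        · simp
      · simp only [mu]
        split_ifs with hc
        · simp only [Pi.add_apply, Pi.single_apply]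
          split_ifs <;> linarith [hc.1, hc.2]
        · simp
    have mu_inl : ∀ i, w i = 0 → ∀ g : I → ℝ, ∑ i', mu (Sum.inl i) i' * g i' = g i := by
      intro i hi g
      simp [mu, hi, Pi.single_apply]
    have mu_inr : ∀ p m, 0 < w p → w m < 0 → ∀ g : I → ℝ,
        ∑ i', mu (Sum.inr (p, m)) i' * g i' = (-w m) * g p + w p * g m := by
      intro p m hp hm g
      simp [mu, hp, hm, Pi.single_apply, add_mul, Finset.sum_add_distrib]
    have mu_w : ∀ J, ∑ i', mu J i' * w i' = 0 := by
      rintro (i | ⟨p, m⟩)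
      · by_cases hi : w i = 0
        · rw [mu_inl i hi, hi]
        · simp [mu, hi]
      · by_cases hc : 0 < w p ∧ w m < 0
        · rw [mu_inr p m hc.1 hc.2]; ring
        · simp only [mu, if_neg hc]; simp
    have swap : ∀ (l : I ⊕ I × I → ℝ) (g : I → ℝ),
        ∑ i, (∑ J, l J * mu J i) * g i = ∑ J, l J * ∑ i, mu J i * g i := by
      intro l g
      simp_rw [Finset.sum_mul, Finset.mul_sum]
      rw [Finset.sum_comm]
      simp_rw [mul_assoc]
    obtain ⟨l, hl0, hl1, hl2⟩ := ih (I ⊕ I × I) (fun j J => ∑ i, mu J i * u j.succ i)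
      (fun J => ∑ i, mu J i * b i) (by
        rintro ⟨c, hc⟩
        apply h
        have hr : ∀ J, 0 ≤ ∑ i, mu J i * (b i - ∑ j, c j * u j.succ i) := by
          intro J
          have h1 := hc J
          have h2 : ∑ i, mu J i * (b i - ∑ j, c j * u j.succ i)
              = ∑ i, mu J i * b i - ∑ j, c j * ∑ i, mu J i * u j.succ i := by
            simp_rw [mul_sub, Finset.sum_sub_distrib, Finset.mul_sum]
            congr 1
            rw [Finset.sum_comm]
            refine Finset.sum_congr rfl fun _ _ => Finset.sum_congr rfl fun _ _ => by ring
          rw [h2]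
          linarith
        obtain ⟨t, ht⟩ := fm_scalar w (fun i => b i - ∑ j, c j * u j.succ i)
          (fun i hi => by
            have := hr (Sum.inl i)
            rwa [mu_inl i hi] at this)
          (fun p m hp hm => by
            have := hr (Sum.inr (p, m))
            rwa [mu_inr p m hp hm] at this)
        refine ⟨Fin.cons t c, fun i => ?_⟩
        rw [Fin.sum_univ_succ]
        simp only [Fin.cons_zero, Fin.cons_succ]
        have := ht i
        simp only [w] at this
        linarith)
    refine ⟨fun i => ∑ J, l J * mu J i,
      fun i => Finset.sum_nonneg fun J _ => mul_nonneg (hl0 J) (mu_nonneg J i), fun j => ?_, ?_⟩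
    · rw [swap]
      refine Fin.cases ?_ (fun j => ?_) j
      · exact Finset.sum_eq_zero fun J _ => by rw [mu_w J, mul_zero]
      · exact hl1 j
    · rw [swap]
      exact hl2

theorem farkas_fintype (K I : Type) [Fintype K] [Fintype I] (u : K → I → ℝ) (b : I → ℝ)
    (h : ¬ ∃ c : K → ℝ, ∀ i, ∑ j, c j * u j i ≤ b i) :
    ∃ l : I → ℝ, (∀ i, 0 ≤ l i) ∧ (∀ j, ∑ i, l i * u j i = 0) ∧ ∑ i, l i * b i < 0 := by
  let e := Fintype.equivFin K
  obtain ⟨l, h0, h1, h2⟩ := farkas_fin (Fintype.card K) I (fun j => u (e.symm j)) b (by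
    rintro ⟨c, hc⟩
    refine h ⟨fun j => c (e j), fun i => ?_⟩
    have := hc i
    rw [← Equiv.sum_comp e] at this
    simpa using this)
  exact ⟨l, h0, fun j => by simpa using h1 (e j), h2⟩

/-- dual characterization of one-sided approximate degree.
`odeg_ε(f) > d` (i.e. no polynomial of degree at most `d` is an `ε`-one-sided
approximation to `f`) iff there exists a dual polynomial `φ` with correlation greater
than `ε` with `f`, unit `ℓ₁`-norm, pure high degree `d`, and one-sided error. -/
theorem odeg_duality (n : ℕ) (f : (Fin n → Bool) → Bool) (ε : ℝ) (hε : 0 < ε) (d : ℕ) :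
    (∀ c : Finset (Fin n) → ℝ, degLE c d → ¬ IsOneSided f (polyOf c) ε) ↔
    ∃ φ : (Fin n → Bool) → ℝ,
      (ε < ∑ x : Fin n → Bool, bval (f x) * φ x) ∧
      (∑ x : Fin n → Bool, |φ x| = 1) ∧
      (∀ S : Finset (Fin n), S.card ≤ d → ∑ x : Fin n → Bool, φ x * chi S x = 0) ∧
      (∀ x : Fin n → Bool, f x = true → φ x ≤ 0) := by
  constructor
  · intro h
    classical
    obtain ⟨l, h0, h1, h2⟩ := farkas_fintype (Finset (Fin n)) ((Fin n → Bool) ⊕ (Fin n → Bool))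
      (fun S i => if S.card ≤ d then
        Sum.elim (fun x => chi S x) (fun x => if f x then 0 else - chi S x) i else 0)
      (Sum.elim (fun x => bval (f x) + ε) (fun x => if f x then 0 else -1 + ε)) (by
        rintro ⟨c, hc⟩
        refine h (fun S => if S.card ≤ d then c S else 0) (fun S hS => by simp [hS]) ?_
        have hp : ∀ x, polyOf (fun S => if S.card ≤ d then c S else 0) x
            = ∑ S, c S * (if S.card ≤ d then chi S x else 0) := by
          intro x
          refine Finset.sum_congr rfl fun S _ => ?_
          by_cases hS : S.card ≤ d
          · simp only [if_pos hS]
          · simp only [if_neg hS, zero_mul, mul_zero]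
        constructor
        · intro x hx
          have a1 := hc (Sum.inl x)
          have a2 := hc (Sum.inr x)
          simp only [Sum.elim_inl, Sum.elim_inr, hx, bval, Bool.false_eq_true, if_false] at a1 a2
          rw [← hp] at a1
          have : ∑ S, c S * (if S.card ≤ d then - chi S x else 0)
              = - polyOf (fun S => if S.card ≤ d then c S else 0) x := by
            rw [hp, ← Finset.sum_neg_distrib]
            refine Finset.sum_congr rfl fun S _ => ?_
            split_ifs <;> simp
          rw [this] at a2
          rw [abs_le]
          constructor <;> linarith
        · intro x hx
          have a1 := hc (Sum.inl x)
          simp only [Sum.elim_inl, hx, bval, if_true] at a1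
          rwa [← hp] at a1)
    let m : (Fin n → Bool) → ℝ := fun x => if f x then 0 else l (Sum.inr x)
    have hm : ∀ x, 0 ≤ m x := fun x => by
      simp only [m]; split_ifs
      · exact le_rfl
      · exact h0 _
    let psi : (Fin n → Bool) → ℝ := fun x => m x - l (Sum.inl x)
    have hpsi : ε * ∑ x, |psi x| < ∑ x, bval (f x) * psi x := by
      rw [Fintype.sum_sum_type] at h2
      simp only [Sum.elim_inl, Sum.elim_inr] at h2
      have e1 : ε * ∑ x, |psi x| ≤ ∑ x, ε * (m x + l (Sum.inl x)) := by
        rw [Finset.mul_sum]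
        refine Finset.sum_le_sum fun x _ => mul_le_mul_of_nonneg_left ?_ hε.le
        rw [abs_le]
        have := hm x
        have := h0 (Sum.inl x)
        constructor <;> simp only [psi] <;> linarith
      have e2 : ∑ x, bval (f x) * psi x - ∑ x, ε * (m x + l (Sum.inl x))
          = -(∑ x, l (Sum.inl x) * (bval (f x) + ε) +
            ∑ x, l (Sum.inr x) * (if f x then 0 else -1 + ε)) := by
        rw [← Finset.sum_sub_distrib, ← Finset.sum_add_distrib, ← Finset.sum_neg_distrib]
        refine Finset.sum_congr rfl fun x _ => ?_
        simp only [psi, m, bval]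
        split_ifs <;> ring
      linarith
    have hpos : 0 < ∑ x, |psi x| := by
      have hnn : 0 ≤ ∑ x, |psi x| := Finset.sum_nonneg fun x _ => abs_nonneg _
      rcases hnn.lt_or_eq with h | h
      · exact h
      · exfalso
        have hz := (Finset.sum_eq_zero_iff_of_nonneg (fun x _ => abs_nonneg (psi x))).1 h.symm
        have : ∑ x, bval (f x) * psi x = 0 := Finset.sum_eq_zero fun x hx => by
          rw [abs_eq_zero.1 (hz x hx), mul_zero]
        rw [this, ← h] at hpsi
        simp at hpsi
    refine ⟨fun x => psi x / ∑ x, |psi x|, ?_, ?_, ?_, ?_⟩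
    · simp_rw [← mul_div_assoc]
      rw [← Finset.sum_div, lt_div_iff₀ hpos]
      exact hpsi
    · simp_rw [abs_div, abs_of_pos hpos]
      rw [← Finset.sum_div, div_self hpos.ne']
    · intro S hS
      have h3 := h1 S
      rw [Fintype.sum_sum_type] at h3
      simp only [Sum.elim_inl, Sum.elim_inr, hS, if_true] at h3
      simp_rw [div_mul_eq_mul_div]
      rw [← Finset.sum_div]
      have : ∑ x, psi x * chi S x = 0 := by
        rw [← neg_eq_zero, ← h3, ← Finset.sum_add_distrib, ← Finset.sum_neg_distrib]
        refine Finset.sum_congr rfl fun x _ => ?_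
        simp only [psi, m]
        split_ifs <;> ring
      rw [this, zero_div]
    · intro x hx
      refine div_nonpos_of_nonpos_of_nonneg ?_ hpos.le
      have := h0 (Sum.inl x)
      simp only [psi, m, hx, if_true]
      linarith
  · rintro ⟨φ, h1, h2, h3, h4⟩ c hc ⟨ha, hb⟩
    have hz : ∑ x, polyOf c x * φ x = 0 := by
      simp only [polyOf, Finset.sum_mul]
      rw [Finset.sum_comm]
      refine Finset.sum_eq_zero fun S _ => ?_
      by_cases hS : S.card ≤ d
      · rw [← mul_zero (c S), ← h3 S hS, Finset.mul_sum]
        exact Finset.sum_congr rfl fun x _ => by ring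
      · simp [hc S (not_le.1 hS)]
    have hle : ∑ x, bval (f x) * φ x - ∑ x, polyOf c x * φ x ≤ ε * ∑ x, |φ x| := by
      rw [← Finset.sum_sub_distrib, Finset.mul_sum]
      refine Finset.sum_le_sum fun x _ => ?_
      rw [← sub_mul]
      cases hx : f x
      · calc (bval false - polyOf c x) * φ x ≤ |(bval false - polyOf c x) * φ x| := le_abs_self _
          _ = |polyOf c x - 1| * |φ x| := by
            rw [abs_mul, abs_sub_comm]; simp [bval]
          _ ≤ ε * |φ x| := mul_le_mul_of_nonneg_right (ha x hx) (abs_nonneg _)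
      · have p1 := hb x hx
        have p2 := h4 x hx
        rw [abs_of_nonpos p2]
        simp only [bval, if_true]
        nlinarith
    rw [hz, h2] at hle
    linarith

end
end

section
/- Let N be a power of 2, m = N·log₂N, and let ED_N : {-1,1}^m → {-1,1} be the Element Distinctness function. Then for every ε > 0 and every integer d ≥ 0, if deg̃_ε(ED_N) > d then odeg_ε(ED_N) > d; consequently odeg_ε(ED_N) = deg̃_ε(ED_N) for every ε > 0. -/
open Finset

noncomputable section

/-- The Element Distinctness function on `N = 2^k` blocks of `k` bits: it is TRUE
(`true`, i.e. `-1`) iff the `N` encoded numbers are pairwise distinct. -/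
def ED (k : ℕ) (x : Fin (2 ^ k) × Fin k → Bool) : Bool :=
  decide (Function.Injective (gOf x))

/-- functions computed by polynomials of degree at most `d` -/
def HasDeg {ι : Type*} [Fintype ι] (d : ℕ) (p : (ι → Bool) → ℝ) : Prop :=
  ∃ c : Finset ι → ℝ, degLE c d ∧ polyOf c = p

theorem HasDeg.add {ι : Type*} [Fintype ι] {d : ℕ} {p q : (ι → Bool) → ℝ}
    (hp : HasDeg d p) (hq : HasDeg d q) : HasDeg d (fun x => p x + q x) := by
  obtain ⟨a, ha, rfl⟩ := hp
  obtain ⟨b, hb, rfl⟩ := hq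
  refine ⟨fun S => a S + b S, fun S hS => by simp [ha S hS, hb S hS], ?_⟩
  funext x
  simp [polyOf, add_mul, Finset.sum_add_distrib]

theorem HasDeg.smul {ι : Type*} [Fintype ι] {d : ℕ} {p : (ι → Bool) → ℝ}
    (r : ℝ) (hp : HasDeg d p) : HasDeg d (fun x => r * p x) := by
  obtain ⟨a, ha, rfl⟩ := hp
  refine ⟨fun S => r * a S, fun S hS => by simp [ha S hS], ?_⟩
  funext x
  simp [polyOf, Finset.mul_sum, mul_assoc]

theorem HasDeg.const {ι : Type*} [Fintype ι] (d : ℕ) (r : ℝ) :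
    HasDeg d (fun _ : ι → Bool => r) := by
  classical
  refine ⟨fun S => if S = ∅ then r else 0, fun S hS => ?_, ?_⟩
  · have : S ≠ ∅ := by
      rintro rfl
      simp at hS
    simp [this]
  · funext x
    simp [polyOf, chi]

theorem HasDeg.sum {ι α : Type*} [Fintype ι] {d : ℕ} (s : Finset α)
    {p : α → (ι → Bool) → ℝ} (hp : ∀ i, HasDeg d (p i)) :
    HasDeg d (fun x => ∑ i ∈ s, p i x) := by
  classical
  induction s using Finset.induction_on with
  | empty => simpa using HasDeg.const (ι := ι) d 0
  | insert a s ha ih => simpa [Finset.sum_insert ha] using (hp a).add ih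

theorem HasDeg.comp {ι : Type*} [Fintype ι] {d : ℕ} {p : (ι → Bool) → ℝ}
    (hp : HasDeg d p) (e : ι ≃ ι) : HasDeg d (fun x => p (fun i => x (e i))) := by
  obtain ⟨a, ha, rfl⟩ := hp
  refine ⟨fun S => a (S.map e.symm.toEmbedding), fun S hS => ha _ (by simpa using hS), ?_⟩
  funext x
  refine Fintype.sum_equiv (Equiv.finsetCongr e.symm) _ _ fun S => ?_
  simp [chi]

theorem gOf_inj {N k : ℕ} {x y : Fin N × Fin k → Bool} (h : ∀ i, gOf x i = gOf y i) :
    x = y := by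
  funext ⟨i, j⟩
  have := congrFun (finFunctionFinEquiv.injective (h i)) j
  by_cases hx : x (i, j) = true <;> by_cases hy : y (i, j) = true <;> simp_all

theorem orbit {k : ℕ} {x y : Fin (2 ^ k) × Fin k → Bool} (hx : ED k x = true)
    (hy : ED k y = true) : ∃ σ : Equiv.Perm (Fin (2 ^ k)), y = fun i => x (σ i.1, i.2) := by
  have hx' : Function.Injective (gOf x) := by simpa [ED] using hx
  have hy' : Function.Injective (gOf y) := by simpa [ED] using hy
  let a := Equiv.ofBijective _ (Finite.injective_iff_bijective.1 hx')
  let b := Equiv.ofBijective _ (Finite.injective_iff_bijective.1 hy')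
  refine ⟨b.trans a.symm, gOf_inj fun i => ?_⟩
  change b i = a ((b.trans a.symm) i)
  simp

theorem ED_perm {k : ℕ} (x : Fin (2 ^ k) × Fin k → Bool) (σ : Equiv.Perm (Fin (2 ^ k))) :
    ED k (fun i => x (σ i.1, i.2)) = ED k x := by
  have h : gOf (fun i : Fin (2 ^ k) × Fin k => x (σ i.1, i.2)) = gOf x ∘ σ := rfl
  simp only [ED, h, Equiv.injective_comp]

theorem approx_of_oneSided (k d : ℕ) (ε : ℝ) (hε : 0 < ε)
    (p : (Fin (2 ^ k) × Fin k → Bool) → ℝ) (hp : HasDeg d p) (h : IsOneSided (ED k) p ε) :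
    ∃ q, HasDeg d q ∧ IsApprox (ED k) q ε := by
  classical
  let n : ℝ := Fintype.card (Equiv.Perm (Fin (2 ^ k)))
  have hn : 0 < n := by
    have : 0 < Fintype.card (Equiv.Perm (Fin (2 ^ k))) := Fintype.card_pos
    exact Nat.cast_pos.2 this
  let q : (Fin (2 ^ k) × Fin k → Bool) → ℝ := fun x =>
    n⁻¹ * ∑ σ : Equiv.Perm (Fin (2 ^ k)), p (fun i => x (σ i.1, i.2))
  have hq : HasDeg d q := HasDeg.smul _ (HasDeg.sum _ fun σ =>
    hp.comp (Equiv.prodCongr σ (Equiv.refl _)))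
  have hle : ∀ (x) (r : ℝ), (∀ σ : Equiv.Perm (Fin (2 ^ k)), p (fun i => x (σ i.1, i.2)) ≤ r) →
      q x ≤ r := fun x r hr => by
    have := Finset.sum_le_sum (fun σ (_ : σ ∈ Finset.univ) => hr σ)
    simp only [Finset.sum_const, Finset.card_univ, nsmul_eq_mul] at this
    rw [inv_mul_le_iff₀ hn]
    exact this
  have hge : ∀ (x) (r : ℝ), (∀ σ : Equiv.Perm (Fin (2 ^ k)), r ≤ p (fun i => x (σ i.1, i.2))) →
      r ≤ q x := fun x r hr => by
    have := Finset.sum_le_sum (fun σ (_ : σ ∈ Finset.univ) => hr σ)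
    simp only [Finset.sum_const, Finset.card_univ, nsmul_eq_mul] at this
    rw [le_inv_mul_iff₀ hn]
    exact this
  have hf : ∀ x, ED k x = false → |q x - 1| ≤ ε := fun x hx => by
    have hb : ∀ σ : Equiv.Perm (Fin (2 ^ k)), |p (fun i => x (σ i.1, i.2)) - 1| ≤ ε :=
      fun σ => h.1 _ (by rw [ED_perm, hx])
    rw [abs_le]
    have h1 := hle x (1 + ε) fun σ => by linarith [(abs_le.1 (hb σ)).2]
    have h2 := hge x (1 - ε) fun σ => by linarith [(abs_le.1 (hb σ)).1]
    constructor <;> linarith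
  have ht : ∀ x, ED k x = true → q x ≤ -1 + ε := fun x hx =>
    hle x _ fun σ => h.2 _ (by rw [ED_perm, hx])
  have hc : ∀ x y, ED k x = true → ED k y = true → q y = q x := fun x y hx hy => by
    obtain ⟨σ, rfl⟩ := orbit hx hy
    simp only [q]
    congr 1
    exact Fintype.sum_equiv (Equiv.mulLeft σ) _ _ fun τ => by simp
  by_cases hlow : ∃ x, ED k x = true ∧ q x < -1
  · obtain ⟨x₀, hx₀, hv⟩ := hlow
    set v := q x₀ with hvdef
    have h1v : 0 < 1 - v := by linarith
    have hs0 : 0 ≤ 2 / (1 - v) := by positivity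
    have hs1 : 2 / (1 - v) ≤ 1 := by rw [div_le_one h1v]; linarith
    set s := 2 / (1 - v) with hs
    have hsv : s * (1 - v) = 2 := by rw [hs]; field_simp
    refine ⟨fun x => s * q x + (1 - s), (hq.smul s).add (HasDeg.const d _), fun x => ?_⟩
    cases hx : ED k x with
    | false =>
      have h1 := hf x hx
      have h2 : s * q x + (1 - s) - bval false = s * (q x - 1) := by simp [bval]; ring
      rw [h2, abs_mul, abs_of_nonneg hs0]
      nlinarith [abs_nonneg (q x - 1)]
    | true =>
      have h1 : q x = v := hc x₀ x hx₀ hx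
      have h2 : s * q x + (1 - s) - bval true = 0 := by
        simp only [bval, h1, if_true]; linarith
      rw [h2, abs_zero]
      exact hε.le
  · push Not at hlow
    refine ⟨q, hq, fun x => ?_⟩
    cases hx : ED k x with
    | false => simpa [bval] using hf x hx
    | true =>
      have h1 := ht x hx
      have h2 := hlow x hx
      simp only [bval, if_true]
      rw [abs_le]
      constructor <;> linarith

theorem oneSided_of_approx {ι : Type*} {f : (ι → Bool) → Bool} {p : (ι → Bool) → ℝ} {ε : ℝ}
    (h : IsApprox f p ε) : IsOneSided f p ε := by
  refine ⟨fun x hx => ?_, fun x hx => ?_⟩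
  · simpa [hx, bval] using h x
  · have h1 := (abs_le.1 (h x)).2
    simp only [hx, bval, if_true] at h1
    linarith

/-- the one-sided `ε`-approximate degree of Element Distinctness equals
its `ε`-approximate degree, for every `ε > 0`. -/
theorem element_distinctness_odeg (k : ℕ) (ε : ℝ) (hε : 0 < ε) :
    (∀ d : ℕ, d < adeg ε (ED k) → d < odeg ε (ED k)) ∧
    odeg ε (ED k) = adeg ε (ED k) := by
  have hset : odeg ε (ED k) = adeg ε (ED k) := by
    unfold odeg adeg
    congr 1
    ext d
    constructor
    · rintro ⟨c, hc, h⟩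
      obtain ⟨q, ⟨c', hc', rfl⟩, hq⟩ := approx_of_oneSided k d ε hε _ ⟨c, hc, rfl⟩ h
      exact ⟨c', hc', hq⟩
    · rintro ⟨c, hc, h⟩
      exact ⟨c, hc, oneSided_of_approx h⟩
  exact ⟨fun d hd => hset ▸ hd, hset⟩

end
end

section
/- There is a constant c > 0 such that for every power of 2 N ≥ 2 with m = N·log₂N and every integer t ≥ 1, the function F = OR_t(ED_N,…,ED_N) : ({-1,1}^m)^t → {-1,1}, the block composition of OR_t with t disjoint copies of the Element Distinctness function, satisfies deg̃_{1−2^{−t}}(F) ≥ c·N^{2/3}/log₂N; that is, every real polynomial of degree less than c·N^{2/3}/log₂N differs from F by more than 1 − 2^{−t} at some input. -/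
open Finset

noncomputable section

/-! ### Fourier expansion: the set defining `adeg` is nonempty -/

lemma polyOf_surj {ι : Type} [Fintype ι] [DecidableEq ι] (F : (ι → Bool) → ℝ) :
    ∃ c : Finset ι → ℝ, polyOf c = F := by
  refine ⟨fun S => ∑ y : ι → Bool, F y * ((1/2) ^ (Fintype.card ι) * chi S y), ?_⟩
  funext x
  have key : ∀ y : ι → Bool, ∑ S : Finset ι, chi S y * chi S x
      = if y = x then (2:ℝ) ^ (Fintype.card ι) else 0 := by
    intro y
    have h1 : ∑ S : Finset ι, chi S y * chi S x = ∏ i : ι, (1 + bval (y i) * bval (x i)) := by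
      rw [Finset.prod_one_add, Finset.powerset_univ]
      refine Finset.sum_congr rfl fun S _ => ?_
      simp only [chi, Finset.prod_mul_distrib]
    rw [h1]
    split_ifs with h
    · subst h
      have : ∀ i, 1 + bval (y i) * bval (y i) = 2 := by
        intro i; cases y i <;> norm_num [bval]
      simp [this]
    · obtain ⟨i, hi⟩ := Function.ne_iff.mp h
      refine Finset.prod_eq_zero (Finset.mem_univ i) ?_
      revert hi
      cases y i <;> cases x i <;> norm_num [bval]
  simp only [polyOf, Finset.sum_mul]
  rw [Finset.sum_comm]
  have : ∀ y : ι → Bool, ∑ S : Finset ι, F y * ((1/2) ^ (Fintype.card ι) * chi S y) * chi S x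
      = F y * (1/2) ^ (Fintype.card ι) * (if y = x then (2:ℝ) ^ (Fintype.card ι) else 0) := by
    intro y
    rw [← key y, Finset.mul_sum]
    refine Finset.sum_congr rfl fun S _ => by ring
  simp only [this]
  simp

lemma adeg_spec {ι : Type} [Fintype ι] [DecidableEq ι] (ε : ℝ) (hε : 0 ≤ ε)
    (f : (ι → Bool) → Bool) :
    ∃ c : Finset ι → ℝ, degLE c (adeg ε f) ∧ IsApprox f (polyOf c) ε := by
  have hne : {d | ∃ c : Finset ι → ℝ, degLE c d ∧ IsApprox f (polyOf c) ε}.Nonempty := by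
    obtain ⟨c, hc⟩ := polyOf_surj (fun x => bval (f x))
    refine ⟨Fintype.card ι, c, ?_, ?_⟩
    · intro S hS
      exact absurd (Finset.card_le_univ S) (by omega)
    · intro x
      rw [hc]; simpa using hε
  exact Nat.sInf_mem hne

/-! ### Duality -/

/-- A finite mixture of points matching statement. -/
lemma duality {ι : Type} [Fintype ι] [DecidableEq ι] (f : (ι → Bool) → Bool) (D : ℕ)
    (hno : ∀ (c : Finset ι → ℝ) (s : ℝ), degLE c D →
      (∀ x, f x = false → polyOf c x < s) →
      (∀ y x, f y = true → f x = false → s < (2/3) * polyOf c y + (1/3) * polyOf c x) → False) :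
    ∃ (I J : Type) (_ : Fintype I) (_ : Fintype J) (w : I → ℝ) (v : J → ℝ)
      (x : I → ι → Bool) (z : J → ι → Bool),
      (∀ i, 0 ≤ w i) ∧ (∀ j, 0 ≤ v j) ∧ ∑ i, w i = 1 ∧ ∑ j, v j = 1 ∧
      (∀ i, f (x i) = false) ∧ (∑ j, (if f (z j) = false then v j else 0) ≤ 1/3) ∧
      ∀ S : Finset ι, S.card ≤ D → ∑ i, w i * chi S (x i) = ∑ j, v j * chi S (z j) := by
  classical
  let e : (ι → Bool) → (Finset ι → ℝ) := fun x S => if S.card ≤ D then chi S x else 0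
  let A : Set (Finset ι → ℝ) := e '' {x | f x = false}
  let B : Set (Finset ι → ℝ) :=
    (fun p : (ι → Bool) × (ι → Bool) => (2/3 : ℝ) • e p.1 + (1/3 : ℝ) • e p.2) ''
      {p | f p.1 = true ∧ f p.2 = false}
  have hA : A.Finite := Set.toFinite _
  have hB : B.Finite := Set.toFinite _
  have hnd : ¬ Disjoint (convexHull ℝ A) (convexHull ℝ B) := by
    intro hd
    obtain ⟨φ, u, v, h1, h2, h3⟩ := geometric_hahn_banach_compact_closed (convex_convexHull ℝ A)
      (hA.isCompact_convexHull ℝ) (convex_convexHull ℝ B) (hB.isClosed_convexHull ℝ) hd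
    let c : Finset ι → ℝ := fun S => if S.card ≤ D then φ (Pi.single S 1) else 0
    have hφ : ∀ x, φ (e x) = polyOf c x := by
      intro x
      have : e x = ∑ S : Finset ι, (e x S) • (Pi.single S (1:ℝ) : Finset ι → ℝ) := by
        funext T
        simp [Finset.sum_apply, Pi.single_apply]
      rw [this, map_sum]
      simp only [polyOf, map_smul, smul_eq_mul]
      refine Finset.sum_congr rfl fun S _ => ?_
      simp only [e, c]
      split_ifs <;> ring
    refine hno c u ?_ ?_ ?_
    · intro S hS
      simp only [c]; rw [if_neg (by omega)]
    · intro x hx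
      rw [← hφ]
      exact h1 _ (subset_convexHull ℝ A ⟨x, hx, rfl⟩)
    · intro y x hy hx
      have := h3 _ (subset_convexHull ℝ B ⟨(y, x), ⟨hy, hx⟩, rfl⟩)
      simp only [map_add, map_smul, smul_eq_mul, hφ] at this
      linarith
  obtain ⟨p, hpA, hpB⟩ := Set.not_disjoint_iff.mp hnd
  rw [mem_convexHull_iff_exists_fintype] at hpA hpB
  obtain ⟨I, hI, w, zA, hw0, hw1, hzA, hsA⟩ := hpA
  obtain ⟨J, hJ, v, zB, hv0, hv1, hzB, hsB⟩ := hpB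
  choose x hx hxe using hzA
  choose q hq hqe using hzB
  refine ⟨I, J × Bool, hI, inferInstance, w, fun jb => v jb.1 * (if jb.2 then 2/3 else 1/3), x,
    fun jb => if jb.2 then (q jb.1).1 else (q jb.1).2, hw0, ?_, hw1, ?_, hx, ?_, ?_⟩
  · rintro ⟨j, b⟩
    have := hv0 j
    cases b <;> simp <;> linarith
  · rw [Fintype.sum_prod_type]
    simp only [Fintype.sum_bool, if_true, Bool.false_eq_true, if_false]
    refine Eq.trans ?_ hv1
    exact Finset.sum_congr rfl fun j _ => by ring
  · rw [Fintype.sum_prod_type]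
    have h : ∀ j, f (q j).1 = true ∧ f (q j).2 = false := fun j => hq j
    simp only [Fintype.sum_bool, if_true, Bool.false_eq_true, if_false, (h _).1, (h _).2]
    simp only [Bool.true_eq_false, if_false, zero_add]
    rw [← Finset.sum_mul, hv1]; norm_num
  · intro S hS
    have e1 := congrFun hsA S
    have e2 := congrFun hsB S
    have : ∑ i, w i * chi S (x i) = p S := by
      rw [← e1]
      simp only [Finset.sum_apply, Pi.smul_apply, smul_eq_mul, ← hxe, e, if_pos hS]
    rw [this, ← e2, Fintype.sum_prod_type]
    simp only [Finset.sum_apply, Pi.smul_apply, smul_eq_mul, ← hqe, e, if_pos hS, Pi.add_apply,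
      Fintype.sum_bool, if_true, Bool.false_eq_true, if_false]
    refine Finset.sum_congr rfl fun j _ => by ring

/-! ### Amplification -/

lemma chi_prod {ι : Type} [DecidableEq ι] [Fintype ι] (t : ℕ) (S : Finset (Fin t × ι))
    (z : Fin t → ι → Bool) :
    chi S (fun p => z p.1 p.2)
      = ∏ i : Fin t, chi (univ.filter fun j => (i, j) ∈ S) (z i) := by
  simp only [chi]
  have : ∀ i, ∏ j ∈ univ.filter (fun j => (i, j) ∈ S), bval (z i j)
      = ∏ j : ι, if (i, j) ∈ S then bval (z i j) else 1 := by
    intro i; rw [Finset.prod_filter]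
  simp only [this]
  rw [← Fintype.prod_prod_type' (f := fun i j => if (i, j) ∈ S then bval (z i j) else 1)]
  rw [← Finset.prod_filter]
  congr 1
  ext x; simp

lemma expect_poly {ι : Type} [DecidableEq ι] [Fintype ι] (t : ℕ) (c : Finset (Fin t × ι) → ℝ)
    {I : Type} [Fintype I] (w : I → ℝ) (x : I → ι → Bool) :
    ∑ a : Fin t → I, (∏ i, w (a i)) * polyOf c (fun p => x (a p.1) p.2)
      = ∑ S : Finset (Fin t × ι), c S *
        ∏ i : Fin t, ∑ j, w j * chi (univ.filter fun l => (i, l) ∈ S) (x j) := by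
  simp only [polyOf, Finset.mul_sum]
  rw [Finset.sum_comm]
  refine Finset.sum_congr rfl fun S _ => ?_
  rw [Fintype.prod_sum, Finset.mul_sum]
  refine Finset.sum_congr rfl fun a _ => ?_
  rw [chi_prod t S (fun i => x (a i)), Finset.prod_mul_distrib]
  ring

lemma amplification {ι : Type} [Fintype ι] [DecidableEq ι] (f : (ι → Bool) → Bool) (D t : ℕ)
    (ht : 1 ≤ t) (c : Finset (Fin t × ι) → ℝ) (hc : degLE c D)
    (hap : IsApprox (orBlock t f) (polyOf c) (1 - (1/2) ^ t))
    (hno : ∀ (c : Finset ι → ℝ) (s : ℝ), degLE c D →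
      (∀ x, f x = false → polyOf c x < s) →
      (∀ y x, f y = true → f x = false → s < (2/3) * polyOf c y + (1/3) * polyOf c x) → False) :
    False := by
  obtain ⟨I, J, _, _, w, v, x, z, hw0, hv0, hw1, hv1, hx, hz, hS⟩ := duality f D hno
  have hE : ∑ a : Fin t → I, (∏ i, w (a i)) * polyOf c (fun p => x (a p.1) p.2)
      = ∑ a : Fin t → J, (∏ i, v (a i)) * polyOf c (fun p => z (a p.1) p.2) := by
    rw [expect_poly, expect_poly]
    refine Finset.sum_congr rfl fun S _ => ?_
    by_cases hSD : S.card ≤ D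
    · congr 1
      refine Finset.prod_congr rfl fun i _ => hS _ (le_trans ?_ hSD)
      refine Finset.card_le_card_of_injOn (fun l => (i, l)) ?_ ?_
      · intro l hl; simpa using hl
      · intro l _ l' _ h; simpa using h
    · rw [hc S (by omega)]; simp
  have hW : ∑ a : Fin t → I, ∏ i, w (a i) = 1 := by
    rw [← Fintype.prod_sum (fun (_ : Fin t) j => w j)]; simp [hw1]
  have hV : ∑ a : Fin t → J, ∏ i, v (a i) = 1 := by
    rw [← Fintype.prod_sum (fun (_ : Fin t) j => v j)]; simp [hv1]
  have hlow : (1/2 : ℝ) ^ t ≤ ∑ a : Fin t → I, (∏ i, w (a i)) * polyOf c (fun p => x (a p.1) p.2) := by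
    calc (1/2 : ℝ) ^ t = ∑ a : Fin t → I, (∏ i, w (a i)) * (1/2 : ℝ) ^ t := by
          rw [← Finset.sum_mul, hW, one_mul]
      _ ≤ _ := by
          refine Finset.sum_le_sum fun a _ => mul_le_mul_of_nonneg_left ?_
            (Finset.prod_nonneg fun i _ => hw0 _)
          have h := hap (fun p => x (a p.1) p.2)
          have h2 : orBlock t f (fun p => x (a p.1) p.2) = false := by
            simp only [orBlock, decide_eq_false_iff_not, not_exists]
            intro i; simp [hx]
          rw [h2] at h
          have := (abs_le.mp h).1
          simp only [bval, Bool.false_eq_true, if_false] at this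
          linarith
  have hup : ∑ a : Fin t → J, (∏ i, v (a i)) * polyOf c (fun p => z (a p.1) p.2)
      ≤ -(1/2 : ℝ) ^ t + 2 * (1/3) ^ t := by
    have h1 : ∀ a : Fin t → J, (∏ i, v (a i)) * polyOf c (fun p => z (a p.1) p.2)
        ≤ (∏ i, v (a i)) * (-(1/2 : ℝ) ^ t)
          + 2 * ∏ i, (if f (z (a i)) = false then v (a i) else 0) := by
      intro a
      have hp : 0 ≤ ∏ i, v (a i) := Finset.prod_nonneg fun i _ => hv0 _
      have h := hap (fun p => z (a p.1) p.2)
      have h' := (abs_le.mp h).2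
      by_cases hall : ∀ i, f (z (a i)) = false
      · simp only [hall, if_true]
        have h2 : orBlock t f (fun p => z (a p.1) p.2) = false := by
          simp only [orBlock, decide_eq_false_iff_not, not_exists]
          intro i; simp [hall]
        rw [h2] at h'
        simp only [bval, Bool.false_eq_true, if_false] at h'
        nlinarith
      · push Not at hall
        obtain ⟨i, hi⟩ := hall
        have h2 : orBlock t f (fun p => z (a p.1) p.2) = true := by
          simp only [orBlock, decide_eq_true_eq]
          exact ⟨i, by simpa using hi⟩
        rw [h2] at h'
        simp only [bval, if_true] at h'
        have h3 : ∏ i, (if f (z (a i)) = false then v (a i) else 0) = 0 :=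
          Finset.prod_eq_zero (Finset.mem_univ i) (if_neg hi)
        rw [h3]
        nlinarith
    refine (Finset.sum_le_sum fun a _ => h1 a).trans ?_
    rw [Finset.sum_add_distrib, ← Finset.sum_mul, hV, ← Finset.mul_sum,
      ← Fintype.prod_sum (fun (_ : Fin t) j => if f (z j) = false then v j else 0)]
    have h0 : 0 ≤ ∑ j, (if f (z j) = false then v j else 0) :=
      Finset.sum_nonneg fun j _ => by split_ifs <;> simp [hv0]
    have : (∏ _i : Fin t, ∑ j, (if f (z j) = false then v j else 0)) ≤ (1/3 : ℝ) ^ t := by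
      rw [Finset.prod_const, Finset.card_univ, Fintype.card_fin]
      exact pow_le_pow_left₀ h0 hz t
    linarith
  have hlt : (1/3 : ℝ) ^ t < (1/2) ^ t := pow_lt_pow_left₀ (by norm_num) (by norm_num) (by omega)
  linarith

/-! ### Approximation theory -/

lemma markov_left (R : Polynomial ℝ) (D : ℕ) (hD : R.natDegree ≤ D) (a L T : ℝ) (haL : a < L)
    (hT : 0 < T) (hb : ∀ x, a ≤ x → x ≤ L → |R.eval x| ≤ T) :
    |R.derivative.eval a| ≤ D ^ 2 * (2 * T / (L - a)) := by
  have main : ∀ σ : ℝ, |σ| = 1 → σ * R.derivative.eval a ≤ D ^ 2 * (2 * T / (L - a)) := by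
    intro σ hσ
    let ℓ : Polynomial ℝ := Polynomial.C (-(L - a) / 2) * Polynomial.X + Polynomial.C (a + (L - a) / 2)
    let P : Polynomial ℝ := Polynomial.C (-σ / T) * R.comp ℓ
    have hℓ : ℓ.natDegree ≤ 1 := by
      exact Polynomial.natDegree_linear_le
    have hPd : P.degree ≤ D := by
      refine Polynomial.natDegree_le_iff_degree_le.mp ?_
      refine (Polynomial.natDegree_C_mul_le _ _).trans ?_
      refine Polynomial.natDegree_comp_le.trans ?_
      calc R.natDegree * ℓ.natDegree ≤ D * 1 := Nat.mul_le_mul hD hℓ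
        _ = D := mul_one _
    have hPb : ∀ x ∈ Set.Icc (-1 : ℝ) 1, |P.eval x| ≤ 1 := by
      rintro x ⟨h1, h2⟩
      have : P.eval x = (-σ / T) * R.eval (-(L - a) / 2 * x + (a + (L - a) / 2)) := by
        simp [P, ℓ, Polynomial.eval_comp]
      rw [this, abs_mul, abs_div, abs_neg, hσ, abs_of_pos hT, one_div, inv_mul_le_iff₀ hT, mul_one]
      apply hb <;> nlinarith
    have h := Polynomial.Chebyshev.eval_iterate_derivative_le_of_forall_abs_le_one (k := 1)
      (le_refl (1:ℝ)) hPd hPb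
    simp only [Function.iterate_one, Polynomial.Chebyshev.derivative_T_eval_one] at h
    have hd : P.derivative.eval 1 = (σ / T) * ((L - a) / 2) * R.derivative.eval a := by
      simp only [P, ℓ, Polynomial.derivative_mul, Polynomial.derivative_C, zero_mul, zero_add,
        Polynomial.derivative_comp, Polynomial.derivative_add, Polynomial.derivative_X, mul_one,
        add_zero, Polynomial.eval_mul, Polynomial.eval_C, Polynomial.eval_comp,
        Polynomial.eval_add, Polynomial.eval_X]
      have : -(L - a) / 2 + (a + (L - a) / 2) = a := by ring
      rw [this]; ring
    rw [hd] at h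
    have hLa : 0 < L - a := by linarith
    rw [show (D:ℝ) ^ 2 * (2 * T / (L - a)) = D ^ 2 * (2 * T) / (L - a) by ring, le_div_iff₀ hLa]
    have h3 : (σ / T) * ((L - a) / 2) * R.derivative.eval a * (2 * T)
      = σ * R.derivative.eval a * (L - a) := by field_simp
    rw [← h3]
    push_cast at h
    exact mul_le_mul_of_nonneg_right h (by positivity)
  rw [abs_le]
  constructor
  · have := main (-1) (by simp); linarith
  · have := main 1 (by simp); linarith

lemma nodal_weight_abs (n i : ℕ) (hi : i ≤ n) :
    |Lagrange.nodalWeight (range (n + 1)) (fun j : ℕ => (j : ℝ)) i|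
      = ((i.factorial * (n - i).factorial : ℕ) : ℝ)⁻¹ := by
  rw [Lagrange.nodalWeight, Finset.prod_inv_distrib, abs_inv, Finset.abs_prod]
  congr 1
  have h1 : ∏ j ∈ (range (n + 1)).erase i, |(i : ℝ) - j|
      = ∏ j ∈ range (n + 1), (if j = i then 1 else |(i : ℝ) - j|) := by
    rw [← Finset.mul_prod_erase (range (n + 1)) _ (Finset.mem_range.mpr (Nat.lt_succ_of_le hi))]
    simp only [if_true, one_mul]
    refine Finset.prod_congr rfl fun j hj => ?_
    rw [if_neg (Finset.ne_of_mem_erase hj)]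
  rw [h1]
  obtain ⟨m, rfl⟩ := Nat.exists_eq_add_of_le hi
  rw [show i + m + 1 = (i + 1) + m by ring, Finset.prod_range_add, Finset.prod_range_succ]
  simp only [if_true, mul_one]
  rw [← Finset.prod_range_reflect]
  push_cast
  rw [show i + m - i = m by omega]
  congr 1
  · rw [← Finset.prod_range_add_one_eq_factorial]
    push_cast
    refine Finset.prod_congr rfl fun j hj => ?_
    have hj' := Finset.mem_range.mp hj
    rw [if_neg (by omega)]
    have : ((i - 1 - j : ℕ) : ℝ) = i - 1 - j := by
      rw [Nat.sub_sub, Nat.cast_sub (by omega)]; push_cast; ring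
    rw [this, abs_of_nonneg] <;> ring_nf
    positivity
  · rw [← Finset.prod_range_add_one_eq_factorial]
    push_cast
    refine Finset.prod_congr rfl fun j hj => ?_
    rw [if_neg (by omega), show (i:ℝ) - (i + 1 + j) = -(j + 1) by ring, abs_neg, abs_of_nonneg]
    positivity

lemma nodal_prod_le (s : ℕ) (θ : ℝ) (h0 : 0 ≤ θ) (h1 : θ ≤ 1) :
    ∏ l ∈ range s, (((l : ℝ) + 1 + θ) * (l + 1 + 1 - θ))
      ≤ (2 - 1 / ((s : ℝ) + 1)) * (s.factorial * (s + 1).factorial) := by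
  induction s with
  | zero => simp; norm_num
  | succ s ih =>
    rw [Finset.prod_range_succ]
    have hs : (0:ℝ) ≤ s := Nat.cast_nonneg s
    have hA : ((s : ℝ) + 1 + θ) * (s + 1 + 1 - θ) ≤ (s + 1) * (s + 2) + 1/4 := by
      nlinarith [sq_nonneg (θ - 1/2)]
    have hF : (0:ℝ) < s.factorial * (s + 1).factorial := by positivity
    have hB : (2 - 1 / ((s : ℝ) + 1)) * ((s + 1) * (s + 2) + 1/4)
        ≤ (2 - 1 / ((s : ℝ) + 1 + 1)) * ((s + 1) * (s + 2)) := by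
      have e1 : (2 - 1 / ((s : ℝ) + 1)) * ((s + 1) * (s + 2) + 1/4)
        = 2 * ((s+1)*(s+2)) + 1/2 - (s+2) - 1/(4 * (s+1)) := by field_simp; ring
      have e2 : (2 - 1 / ((s : ℝ) + 1 + 1)) * ((s + 1) * (s + 2))
        = 2 * ((s+1)*(s+2)) - (s+1) := by field_simp; ring
      rw [e1, e2]
      have : 0 < 1/(4 * ((s:ℝ)+1)) := by positivity
      linarith
    have hC : 0 ≤ 2 - 1 / ((s : ℝ) + 1) := by
      have : 1 / ((s : ℝ) + 1) ≤ 1 := by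
        rw [div_le_one (by positivity)]; linarith
      linarith
    have h2 : 0 ≤ ((s : ℝ) + 1 + θ) * (s + 1 + 1 - θ) := by
      apply mul_nonneg <;> linarith
    calc _ ≤ (2 - 1 / ((s : ℝ) + 1)) * (s.factorial * (s + 1).factorial)
            * (((s : ℝ) + 1 + θ) * (s + 1 + 1 - θ)) := mul_le_mul_of_nonneg_right ih h2
      _ ≤ (2 - 1 / ((s : ℝ) + 1)) * (s.factorial * (s + 1).factorial)
            * ((s + 1) * (s + 2) + 1/4) :=
          mul_le_mul_of_nonneg_left hA (mul_nonneg hC hF.le)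
      _ = (2 - 1 / ((s : ℝ) + 1)) * ((s + 1) * (s + 2) + 1/4) *
            (s.factorial * (s + 1).factorial) := by ring
      _ ≤ (2 - 1 / ((s : ℝ) + 1 + 1)) * ((s + 1) * (s + 2)) *
            (s.factorial * (s + 1).factorial) := mul_le_mul_of_nonneg_right hB hF.le
      _ = _ := by
          rw [Nat.factorial_succ (s+1), Nat.factorial_succ s]; push_cast; ring

lemma fact_mul_ge (s i : ℕ) (hi : i ≤ 2 * s + 1) :
    s.factorial * (s + 1).factorial ≤ i.factorial * (2 * s + 1 - i).factorial := by
  have h1 := Nat.choose_mul_factorial_mul_factorial hi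
  have h2 := Nat.choose_mul_factorial_mul_factorial (show s ≤ 2 * s + 1 by omega)
  have h3 := Nat.choose_le_middle i (2 * s + 1)
  rw [show (2 * s + 1) / 2 = s by omega] at h3
  rw [show 2 * s + 1 - s = s + 1 by omega] at h2
  have hpos : 0 < (2 * s + 1).choose i := Nat.choose_pos hi
  have h4 : (2 * s + 1).choose i * (s.factorial * (s + 1).factorial)
      ≤ (2 * s + 1).choose i * (i.factorial * (2 * s + 1 - i).factorial) := by
    calc _ ≤ (2 * s + 1).choose s * (s.factorial * (s + 1).factorial) := Nat.mul_le_mul_right _ h3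
      _ = _ := by rw [← mul_assoc, ← mul_assoc, h1, h2]
  exact Nat.le_of_mul_le_mul_left h4 hpos

lemma lebesgue_aux (h : Polynomial ℝ) (s : ℕ) (hd : h.natDegree ≤ 2 * s + 1) (M : ℝ)
    (hM : ∀ i : ℕ, i < 2 * s + 2 → |h.eval (i : ℝ)| ≤ M) (θ : ℝ) (h0 : 0 ≤ θ) (h1 : θ ≤ 1) :
    |h.eval (s + θ)| ≤ M * (2 + (harmonic s : ℝ)) := by
  have hM0 : 0 ≤ M := (abs_nonneg _).trans (hM 0 (by omega))
  have hH : (harmonic s : ℝ) = ∑ l ∈ range s, ((l : ℝ) + 1)⁻¹ := by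
    simp [harmonic]
  have hH0 : (0:ℝ) ≤ harmonic s := by
    rw [hH]; exact Finset.sum_nonneg fun i _ => by positivity
  rcases h0.eq_or_lt with rfl | h0'
  · rw [add_zero]
    have := hM s (by omega)
    nlinarith
  rcases h1.eq_or_lt with rfl | h1'
  · have := hM (s + 1) (by omega)
    push_cast at this
    nlinarith
  have hinj : Set.InjOn (fun j : ℕ => (j : ℝ)) (range (2 * s + 1 + 1) : Finset ℕ) :=
    fun a _ b _ hab => Nat.cast_injective (R := ℝ) hab
  have hinterp := Lagrange.eq_interpolate_of_eval_eq (s := range (2 * s + 1 + 1))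
    (v := fun j : ℕ => (j : ℝ)) (fun i => h.eval (i : ℝ)) (f := h) hinj
    (by
      rw [Finset.card_range]
      refine lt_of_le_of_lt Polynomial.degree_le_natDegree ?_
      exact_mod_cast Nat.lt_succ_of_le hd) (fun i _ => rfl)
  have hnn : ∀ i ∈ range (2 * s + 1 + 1), (s + θ : ℝ) ≠ (fun j : ℕ => (j : ℝ)) i := by
    intro i _ he
    simp only at he
    have a1 : (s : ℝ) < i := by linarith
    have a2 : (i : ℝ) < s + 1 := by linarith
    have a3 : s < i := by exact_mod_cast a1
    have a4 : i < s + 1 := by exact_mod_cast a2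
    omega
  have hev := Lagrange.eval_interpolate_not_at_node (fun i : ℕ => h.eval (i : ℝ)) hnn
  rw [← hinterp] at hev
  rw [hev, abs_mul, Lagrange.eval_nodal, Finset.abs_prod]
  set G : ℝ := ((s.factorial * (s + 1).factorial : ℕ) : ℝ) with hG
  have hGpos : 0 < G := by rw [hG]; positivity
  have hprod : ∏ i ∈ range (2 * s + 1 + 1), |(s + θ : ℝ) - i| ≤ θ * (1 - θ) * (2 * G) := by
    rw [show 2 * s + 1 + 1 = (s + 1) + (s + 1) by ring, Finset.prod_range_add,
      ← Finset.prod_range_reflect, ← Finset.prod_mul_distrib, Finset.prod_range_succ']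
    have e0 : |(s + θ : ℝ) - ((s + 1 - 1 - 0 : ℕ) : ℝ)| * |(s + θ : ℝ) - ((s + 1 + 0 : ℕ) : ℝ)|
        = θ * (1 - θ) := by
      simp only [Nat.add_sub_cancel, Nat.sub_zero, add_zero]
      push_cast
      rw [show (s + θ : ℝ) - s = θ by ring, show (s + θ : ℝ) - (s + 1) = -(1 - θ) by ring, abs_neg,
        abs_of_pos h0', abs_of_pos (by linarith)]
    rw [e0, mul_comm]
    refine mul_le_mul_of_nonneg_left ?_ (mul_nonneg h0 (by linarith))
    have e1 : ∀ l ∈ range s, |(s + θ : ℝ) - ((s + 1 - 1 - (l + 1) : ℕ) : ℝ)| *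
        |(s + θ : ℝ) - ((s + 1 + (l + 1) : ℕ) : ℝ)| = ((l : ℝ) + 1 + θ) * (l + 1 + 1 - θ) := by
      intro l hl
      have hl' := Finset.mem_range.mp hl
      have hl0 : (0:ℝ) ≤ l := Nat.cast_nonneg l
      rw [Nat.add_sub_cancel, Nat.cast_sub (by omega)]
      push_cast
      rw [show (s + θ : ℝ) - (s - (l + 1)) = l + 1 + θ by ring,
        show (s + θ : ℝ) - (s + 1 + (l + 1)) = -(l + 1 + 1 - θ) by ring, abs_neg,
        abs_of_nonneg (by linarith), abs_of_nonneg (by linarith)]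
    rw [Finset.prod_congr rfl e1]
    refine (nodal_prod_le s θ h0 h1).trans ?_
    rw [hG]; push_cast
    refine mul_le_mul_of_nonneg_right ?_ (by positivity)
    have : 0 < 1 / ((s : ℝ) + 1) := by positivity
    linarith
  have hsum : |∑ i ∈ range (2 * s + 1 + 1), Lagrange.nodalWeight (range (2 * s + 1 + 1))
      (fun j : ℕ => (j : ℝ)) i * ((s + θ : ℝ) - i)⁻¹ * h.eval (i : ℝ)|
      ≤ G⁻¹ * M * ∑ i ∈ range (2 * s + 1 + 1), |(s + θ : ℝ) - i|⁻¹ := by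
    refine (Finset.abs_sum_le_sum_abs _ _).trans ?_
    rw [Finset.mul_sum]
    refine Finset.sum_le_sum fun i hi => ?_
    have hi' : i ≤ 2 * s + 1 := Nat.lt_succ_iff.mp (Finset.mem_range.mp hi)
    rw [abs_mul, abs_mul, nodal_weight_abs _ _ hi', abs_inv]
    have b1 : ((i.factorial * (2 * s + 1 - i).factorial : ℕ) : ℝ)⁻¹ ≤ G⁻¹ := by
      apply inv_anti₀ hGpos
      rw [hG]; exact_mod_cast fact_mul_ge s i hi'
    have b2 := hM i (by omega)
    have b3 : 0 ≤ |(s + θ : ℝ) - i|⁻¹ := by positivity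
    calc _ ≤ G⁻¹ * |(s + θ : ℝ) - i|⁻¹ * M := by gcongr
      _ = _ := by ring
  have hsum2 : ∑ i ∈ range (2 * s + 1 + 1), |(s + θ : ℝ) - i|⁻¹
      ≤ θ⁻¹ + (1 - θ)⁻¹ + 2 * harmonic s := by
    rw [show 2 * s + 1 + 1 = (s + 1) + (s + 1) by ring, Finset.sum_range_add,
      ← Finset.sum_range_reflect, ← Finset.sum_add_distrib, Finset.sum_range_succ']
    have e0 : |(s + θ : ℝ) - ((s + 1 - 1 - 0 : ℕ) : ℝ)|⁻¹ + |(s + θ : ℝ) - ((s + 1 + 0 : ℕ) : ℝ)|⁻¹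
        = θ⁻¹ + (1 - θ)⁻¹ := by
      simp only [Nat.add_sub_cancel, Nat.sub_zero, add_zero]
      push_cast
      rw [show (s + θ : ℝ) - s = θ by ring, show (s + θ : ℝ) - (s + 1) = -(1 - θ) by ring, abs_neg,
        abs_of_pos h0', abs_of_pos (by linarith)]
    rw [e0, add_comm]
    refine add_le_add le_rfl ?_
    rw [hH, Finset.mul_sum]
    refine Finset.sum_le_sum fun l hl => ?_
    have hl' := Finset.mem_range.mp hl
    have hl0 : (0:ℝ) ≤ l := Nat.cast_nonneg l
    rw [Nat.add_sub_cancel, Nat.cast_sub (by omega)]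
    push_cast
    rw [show (s + θ : ℝ) - (s - (l + 1)) = l + 1 + θ by ring,
      show (s + θ : ℝ) - (s + 1 + (l + 1)) = -(l + 1 + 1 - θ) by ring, abs_neg,
      abs_of_nonneg (by linarith), abs_of_nonneg (by linarith)]
    have c1 : ((l:ℝ) + 1 + θ)⁻¹ ≤ ((l:ℝ) + 1)⁻¹ := by
      apply inv_anti₀ <;> linarith
    have c2 : ((l:ℝ) + 1 + 1 - θ)⁻¹ ≤ ((l:ℝ) + 1)⁻¹ := by
      apply inv_anti₀ <;> linarith
    linarith
  have hθ : 0 < 1 - θ := by linarith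
  calc _ ≤ θ * (1 - θ) * (2 * G) * (G⁻¹ * M * (θ⁻¹ + (1 - θ)⁻¹ + 2 * harmonic s)) := by
        refine mul_le_mul hprod (hsum.trans ?_) (abs_nonneg _) (by positivity)
        exact mul_le_mul_of_nonneg_left hsum2 (by positivity)
    _ = M * (2 + 4 * (θ * (1 - θ)) * harmonic s) := by
        field_simp; ring
    _ ≤ _ := by
        refine mul_le_mul_of_nonneg_left ?_ hM0
        have : 4 * (θ * (1 - θ)) ≤ 1 := by nlinarith [sq_nonneg (θ - 1/2)]
        nlinarith

lemma lebesgue (h : Polynomial ℝ) (s : ℕ) (hd : h.natDegree ≤ 2 * s + 1) (M b : ℝ)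
    (hM : ∀ i : ℕ, i < 2 * s + 2 → |h.eval (b + i)| ≤ M) (θ : ℝ) (h0 : 0 ≤ θ) (h1 : θ ≤ 1) :
    |h.eval (b + s + θ)| ≤ M * (2 + (harmonic s : ℝ)) := by
  have := lebesgue_aux (h.comp (Polynomial.X + Polynomial.C b)) s (by
    rw [Polynomial.natDegree_comp, Polynomial.natDegree_X_add_C, mul_one]; exact hd) M
    (fun i hi => by simpa [Polynomial.eval_comp, add_comm] using hM i hi) θ h0 h1
  rw [show b + s + θ = s + θ + b by ring]
  simpa [Polynomial.eval_comp] using this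

/-! ### Bivariate polynomials (restricted along the lines that we need) -/

/-- `Q` is a bivariate function that restricts to a polynomial of degree at most `D` in the
second variable, and along the lines `(x a, a)`. -/
def Good (D : ℕ) (Q : ℝ → ℝ → ℝ) : Prop :=
  (∀ w, ∃ p : Polynomial ℝ, p.natDegree ≤ D ∧ ∀ a, p.eval a = Q w a) ∧
  (∀ a, ∃ p : Polynomial ℝ, p.natDegree ≤ D ∧ ∀ x, p.eval x = Q (x * a) a)

lemma Good.mono {D D' : ℕ} {Q : ℝ → ℝ → ℝ} (h : Good D Q) (hD : D ≤ D') : Good D' Q := by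
  constructor
  · intro w; obtain ⟨p, hp, h'⟩ := h.1 w; exact ⟨p, hp.trans hD, h'⟩
  · intro w; obtain ⟨p, hp, h'⟩ := h.2 w; exact ⟨p, hp.trans hD, h'⟩

lemma good_const (c : ℝ) : Good 0 (fun _ _ => c) :=
  ⟨fun _ => ⟨Polynomial.C c, by simp, by simp⟩, fun _ => ⟨Polynomial.C c, by simp, by simp⟩⟩

lemma good_snd : Good 1 (fun _ a => a) :=
  ⟨fun _ => ⟨Polynomial.X, by simp, by simp⟩, fun a => ⟨Polynomial.C a, by simp, by simp⟩⟩

lemma good_fst : Good 1 (fun w _ => w) :=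
  ⟨fun w => ⟨Polynomial.C w, by simp, by simp⟩,
   fun a => ⟨Polynomial.X * Polynomial.C a,
    (Polynomial.natDegree_mul_C_le _ _).trans (by simp), fun x => by
      rw [Polynomial.eval_mul, Polynomial.eval_X, Polynomial.eval_C]⟩⟩

lemma Good.add {D : ℕ} {P Q : ℝ → ℝ → ℝ} (h : Good D P) (h' : Good D Q) :
    Good D (fun w a => P w a + Q w a) := by
  constructor
  · intro w
    obtain ⟨p, hp, e⟩ := h.1 w; obtain ⟨p', hp', e'⟩ := h'.1 w
    exact ⟨p + p', Polynomial.natDegree_add_le_of_degree_le hp hp', by simp [e, e']⟩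
  · intro w
    obtain ⟨p, hp, e⟩ := h.2 w; obtain ⟨p', hp', e'⟩ := h'.2 w
    exact ⟨p + p', Polynomial.natDegree_add_le_of_degree_le hp hp', by simp [e, e']⟩

lemma Good.mul {D D' : ℕ} {P Q : ℝ → ℝ → ℝ} (h : Good D P) (h' : Good D' Q) :
    Good (D + D') (fun w a => P w a * Q w a) := by
  constructor
  · intro w
    obtain ⟨p, hp, e⟩ := h.1 w; obtain ⟨p', hp', e'⟩ := h'.1 w
    exact ⟨p * p', Polynomial.natDegree_mul_le_of_le hp hp', by simp [e, e']⟩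
  · intro w
    obtain ⟨p, hp, e⟩ := h.2 w; obtain ⟨p', hp', e'⟩ := h'.2 w
    exact ⟨p * p', Polynomial.natDegree_mul_le_of_le hp hp', by simp [e, e']⟩

lemma Good.smul {D : ℕ} {Q : ℝ → ℝ → ℝ} (c : ℝ) (h : Good D Q) :
    Good D (fun w a => c * Q w a) := by
  simpa using (good_const c).mul h

lemma good_sum {κ : Type} (s : Finset κ) {D : ℕ} (Q : κ → ℝ → ℝ → ℝ)
    (h : ∀ i ∈ s, Good D (Q i)) : Good D (fun w a => ∑ i ∈ s, Q i w a) := by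
  classical
  induction s using Finset.induction_on with
  | empty => simpa using (good_const 0).mono (Nat.zero_le D)
  | insert i s hi ih =>
    simp only [Finset.sum_insert hi]
    exact (h i (by simp)).add (ih fun j hj => h j (by simp [hj]))

lemma Good.pow {D : ℕ} {Q : ℝ → ℝ → ℝ} (h : Good D Q) (n : ℕ) :
    Good (n * D) (fun w a => Q w a ^ n) := by
  induction n with
  | zero => simpa using good_const 1
  | succ n ih =>
    simp only [pow_succ]
    exact (ih.mul h).mono (by rw [Nat.succ_mul])

lemma good_desc (u : ℕ) : Good u (fun w a => ∏ l ∈ range u, (w - l * a)) := by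
  induction u with
  | zero => simpa using good_const 1
  | succ u ih =>
    simp only [Finset.prod_range_succ]
    refine ih.mul ?_
    have := good_fst.add (good_snd.smul (-(u:ℝ)))
    simpa [sub_eq_add_neg] using this

/-! ### The sampling distribution -/

/-- weight of a single sample: an atom (of mass `a`) or the diffuse part. -/
def wt (j : ℕ) (a : ℝ) (o : Option (Fin j)) : ℝ := o.elim (1 - j * a) (fun _ => a)

lemma wt_sum (j : ℕ) (a : ℝ) : ∑ o, wt j a o = 1 := by
  rw [Fintype.sum_option]; simp [wt]

lemma wt_nonneg (j : ℕ) (a : ℝ) (ha : 0 ≤ a) (hj : j * a ≤ 1) (o : Option (Fin j)) :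
    0 ≤ wt j a o := by
  cases o <;> simp [wt] <;> linarith

/-- extend by `none`. -/
def extA {β γ : Type} [DecidableEq β] (A : Finset β) (v : A → γ) (i : β) : Option γ :=
  if h : i ∈ A then some (v ⟨i, h⟩) else none

lemma extA_bij (β γ : Type) [DecidableEq β] [Fintype β] :
    Function.Bijective (fun p : (Σ A : Finset β, (A → γ)) => extA p.1 p.2) := by
  constructor
  · rintro ⟨A, v⟩ ⟨A', v'⟩ h
    have hA : A = A' := by
      ext i
      have := congrFun h i
      simp only [extA] at this
      by_cases h1 : i ∈ A <;> by_cases h2 : i ∈ A' <;> simp_all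
    subst hA
    congr 1
    funext i
    have := congrFun h i
    simpa [extA] using this
  · intro c
    classical
    refine ⟨⟨univ.filter fun i => (c i).isSome, fun i => (c i).get (Finset.mem_filter.mp i.2).2⟩, ?_⟩
    funext i
    simp only [extA]
    by_cases h : (c i).isSome
    · simp [h]
    · simp only [mem_filter, mem_univ, true_and, h]
      simp at h; simp [h]

lemma sum_decomp {β : Type} [DecidableEq β] [Fintype β] (j : ℕ) (a : ℝ)
    (φ : (β → Option (Fin j)) → ℝ) :
    ∑ c : β → Option (Fin j), (∏ i, wt j a (c i)) * φ c
      = ∑ A : Finset β, (1 - j * a) ^ (Fintype.card β - A.card) *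
          (a ^ A.card * ∑ v : A → Fin j, φ (extA A v)) := by
  rw [← (extA_bij β (Fin j)).sum_comp, Fintype.sum_sigma]
  refine Finset.sum_congr rfl fun A _ => ?_
  rw [Finset.mul_sum, Finset.mul_sum]
  refine Finset.sum_congr rfl fun v _ => ?_
  have : ∏ i, wt j a (extA A v i) = (1 - j * a) ^ (Fintype.card β - A.card) * a ^ A.card := by
    have h1 : ∀ i, wt j a (extA A v i) = if i ∈ A then a else 1 - j * a := by
      intro i
      simp only [extA]
      split_ifs <;> simp [wt]
    simp only [h1]
    rw [Finset.prod_ite, Finset.prod_const, Finset.prod_const, mul_comm]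
    congr 2
    · rw [Finset.filter_not]
      simp [Finset.card_sdiff, Finset.card_univ]
    · simp
  rw [this]; ring

instance finiteSetoid (α : Type) [Finite α] : Finite (Setoid α) :=
  Finite.of_injective (fun s : Setoid α => s.r) (fun s t h => by
    ext x y
    exact iff_of_eq (congrFun (congrFun h x) y))

instance fintypeSetoid (α : Type) [Finite α] : Fintype (Setoid α) := Fintype.ofFinite _

instance fintypeQuotient (α : Type) [Finite α] (s : Setoid α) : Fintype (Quotient s) :=
  Fintype.ofFinite _

open Classical in
lemma card_ker {α : Type} [Fintype α] [DecidableEq α] (j : ℕ) (ρ : Setoid α) :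
    ((univ.filter fun v : α → Fin j => Setoid.ker v = ρ).card : ℕ)
      = j.descFactorial (Fintype.card (Quotient ρ)) := by
  classical
  have e : {v : α → Fin j // Setoid.ker v = ρ} ≃ (Quotient ρ ↪ Fin j) :=
    { toFun := fun v => ⟨Quotient.lift v.1 (fun x y h => by
          have : (Setoid.ker v.1) x y := by rw [v.2]; exact h
          exact this), by
          rintro ⟨x⟩ ⟨y⟩ h
          refine Quotient.sound ?_
          have h' : (Setoid.ker v.1) x y := h
          rw [v.2] at h'; exact h'⟩
      invFun := fun e => ⟨fun x => e (Quotient.mk ρ x), by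
        ext x y
        constructor
        · intro h
          exact Quotient.exact (e.injective h)
        · intro h
          exact congrArg e (Quotient.sound h)⟩
      left_inv := fun v => by ext; rfl
      right_inv := fun e => by
        ext x
        induction x using Quotient.inductionOn
        rfl }
  rw [← Fintype.card_subtype, Fintype.card_congr e, Fintype.card_embedding_eq, Fintype.card_fin]

lemma sum_ker {α : Type} [Fintype α] [DecidableEq α] (j : ℕ) (Ψ : Setoid α → ℝ) :
    ∑ v : α → Fin j, Ψ (Setoid.ker v)
      = ∑ ρ : Setoid α, (j.descFactorial (Fintype.card (Quotient ρ)) : ℝ) * Ψ ρ := by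
  classical
  rw [← Finset.sum_fiberwise univ (fun v : α → Fin j => Setoid.ker v)]
  refine Finset.sum_congr rfl fun ρ _ => ?_
  rw [← card_ker j ρ]
  rw [Finset.sum_congr rfl (fun v hv => by rw [(Finset.mem_filter.mp hv).2])]
  simp

lemma desc_mul_pow (j u n : ℕ) (hu : u ≤ n) (a : ℝ) :
    a ^ n * (j.descFactorial u : ℝ) = (∏ l ∈ range u, ((j * a : ℝ) - l * a)) * a ^ (n - u) := by
  have : (∏ l ∈ range u, ((j * a : ℝ) - l * a)) = (j.descFactorial u : ℝ) * a ^ u := by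
    rw [← descPochhammer_eval_eq_descFactorial ℝ, descPochhammer_eval_eq_prod_range]
    simp only [← sub_mul]
    rw [Finset.prod_mul_distrib]; simp
  rw [this, mul_assoc, ← pow_add, Nat.add_sub_cancel' hu, mul_comm]

/-- polynomiality of the expectation of a pattern function. -/
lemma pattern_poly {β : Type} [Fintype β] [DecidableEq β]
    (Ψ : (A : Finset β) → Setoid A → ℝ) :
    ∃ Q, Good (Fintype.card β) Q ∧ ∀ (j : ℕ) (a : ℝ) (φ : (β → Option (Fin j)) → ℝ),
      (∀ (A : Finset β) (v : A → Fin j), φ (extA A v) = Ψ A (Setoid.ker v)) →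
      ∑ c : β → Option (Fin j), (∏ i, wt j a (c i)) * φ c = Q (j * a) a := by
  refine ⟨fun w a => ∑ A : Finset β, (1 + (-1) * w) ^ (Fintype.card β - A.card) *
    ∑ ρ : Setoid A, Ψ A ρ * ((∏ l ∈ range (Fintype.card (Quotient ρ)), (w - l * a)) *
      a ^ (A.card - Fintype.card (Quotient ρ))), ?_, ?_⟩
  · refine good_sum _ _ fun A _ => ?_
    have hA : A.card ≤ Fintype.card β := Finset.card_le_univ A
    have h1 : Good (Fintype.card β - A.card)
        (fun w _ => (1 + (-1) * w) ^ (Fintype.card β - A.card)) := by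
      have := (((good_const 1).mono (Nat.zero_le 1)).add (good_fst.smul (-1))).pow
        (Fintype.card β - A.card)
      exact this.mono (by omega)
    have h2 : Good A.card (fun w a => ∑ ρ : Setoid A, Ψ A ρ *
        ((∏ l ∈ range (Fintype.card (Quotient ρ)), (w - l * a)) *
      a ^ (A.card - Fintype.card (Quotient ρ)))) := by
      refine good_sum _ _ fun ρ _ => Good.smul _ ?_
      have hq : Fintype.card (Quotient ρ) ≤ A.card := by
        have := Fintype.card_le_of_surjective (Quotient.mk ρ) Quotient.mk_surjective
        simpa using this
      exact ((good_desc _).mul (good_snd.pow _)).mono (by omega)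
    exact (h1.mul h2).mono (by omega)
  · intro j a φ hφ
    rw [sum_decomp]
    refine Finset.sum_congr rfl fun A _ => ?_
    congr 1
    · ring
    · simp only [hφ]
      rw [sum_ker, Finset.mul_sum]
      refine Finset.sum_congr rfl fun ρ _ => ?_
      have hq : Fintype.card (Quotient ρ) ≤ A.card := by
        have := Fintype.card_le_of_surjective (Quotient.mk ρ) Quotient.mk_surjective
        simpa using this
      rw [← mul_assoc, desc_mul_pow _ _ _ hq]; ring

/-! ### Collision pattern -/

/-- The collision pattern of a sample. -/
def pat {V γ : Type} (c : V → Option γ) : Setoid V where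
  r i i' := i = i' ∨ (c i = c i' ∧ c i ≠ none)
  iseqv :=
    { refl := fun _ => Or.inl rfl
      symm := by
        rintro x y (h | ⟨h, h'⟩)
        · exact Or.inl h.symm
        · exact Or.inr ⟨h.symm, h ▸ h'⟩
      trans := by
        rintro x y z (h | ⟨h, h'⟩) (g | ⟨g, g'⟩)
        · exact Or.inl (h.trans g)
        · subst h; exact Or.inr ⟨g, g'⟩
        · subst g; exact Or.inr ⟨h, h'⟩
        · exact Or.inr ⟨h.trans g, h'⟩ }

lemma pat_iff {V γ : Type} (c : V → Option γ) (i i' : V) :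
    (pat c) i i' ↔ (i = i' ∨ (c i = c i' ∧ c i ≠ none)) := Iff.rfl

lemma pat_map {V γ γ' : Type} (c : V → Option γ) (e : γ → γ') (he : Function.Injective e) :
    pat (fun i => (c i).map e) = pat c := by
  ext i i'
  rw [pat_iff, pat_iff]
  simp only [ne_eq, Option.map_eq_none_iff, (Option.map_injective he).eq_iff]

/-- extend a sample on `B` by `none` -/
def extB {V γ : Type} [DecidableEq V] (B : Finset V) (d : {x // x ∈ B} → Option γ) (i : V) :
    Option γ := if h : i ∈ B then d ⟨i, h⟩ else none

lemma marginal {V : Type} [Fintype V] [DecidableEq V] (B : Finset V) (j : ℕ) (a : ℝ)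
    (φ : (V → Option (Fin j)) → ℝ)
    (hφ : ∀ c, φ c = φ (extB B (fun i => c i.1))) :
    ∑ c : V → Option (Fin j), (∏ i, wt j a (c i)) * φ c
      = ∑ d : {x // x ∈ B} → Option (Fin j), (∏ i, wt j a (d i)) * φ (extB B d) := by
  rw [← (Equiv.piEquivPiSubtypeProd (· ∈ B) (fun _ => Option (Fin j))).symm.sum_comp,
    Fintype.sum_prod_type]
  refine Finset.sum_congr rfl fun d _ => ?_
  have h1 : ∀ e : {x // x ∉ B} → Option (Fin j),
      (∏ i, wt j a ((Equiv.piEquivPiSubtypeProd (· ∈ B) (fun _ => Option (Fin j))).symm (d, e) i)) *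
        φ ((Equiv.piEquivPiSubtypeProd (· ∈ B) (fun _ => Option (Fin j))).symm (d, e))
      = ((∏ i, wt j a (d i)) * φ (extB B d)) * ∏ i, wt j a (e i) := by
    intro e
    rw [hφ]
    have h2 : extB B (fun i => (Equiv.piEquivPiSubtypeProd (· ∈ B)
        (fun _ => Option (Fin j))).symm (d, e) i.1) = extB B d := by
      funext i
      simp only [extB]
      split_ifs with h
      · simp [h]
      · rfl
    have h3 : ∀ i : {x // x ∈ B}, (Equiv.piEquivPiSubtypeProd (· ∈ B)
        (fun _ => Option (Fin j))).symm (d, e) i = d i := by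
      intro i; simp
    have h4 : ∀ i : {x // x ∉ B}, (Equiv.piEquivPiSubtypeProd (· ∈ B)
        (fun _ => Option (Fin j))).symm (d, e) i = e i := by
      intro i; simp [i.2]
    have h5 : ∏ i, wt j a ((Equiv.piEquivPiSubtypeProd (· ∈ B)
        (fun _ => Option (Fin j))).symm (d, e) i)
        = (∏ i : {x // x ∈ B}, wt j a (d i)) * ∏ i : {x // x ∉ B}, wt j a (e i) := by
      rw [← Fintype.prod_subtype_mul_prod_subtype (· ∈ B)]
      simp only [h3, h4]
      congr!
    rw [h2, h5]; ring
  simp only [h1]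
  rw [← Finset.mul_sum, ← Fintype.prod_sum (fun (_ : {x // x ∉ B}) o => wt j a o)]
  simp only [wt_sum, Finset.prod_const_one, mul_one]

/-- The expectation of a local function of the pattern is polynomial of low degree. -/
lemma local_poly {V : Type} [Fintype V] [DecidableEq V] (B : Finset V) (Θ : Setoid V → ℝ)
    (hΘ : ∀ r r' : Setoid V, (∀ i ∈ B, ∀ i' ∈ B, r i i' ↔ r' i i') → Θ r = Θ r') :
    ∃ Q, Good B.card Q ∧ ∀ (j : ℕ) (a : ℝ),
      ∑ c : V → Option (Fin j), (∏ i, wt j a (c i)) * Θ (pat c) = Q (j * a) a := by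
  obtain ⟨Q, hQ, h⟩ := pattern_poly (β := {x // x ∈ B})
    (fun A ρ => Θ (pat (extB B (extA A (fun x => Quotient.mk ρ x)))))
  refine ⟨Q, by simpa using hQ, fun j a => ?_⟩
  rw [marginal B j a (fun c => Θ (pat c)), h j a]
  · intro A v
    congr 1
    have hinj : Function.Injective (Quotient.lift v (fun x y h => h) :
        Quotient (Setoid.ker v) → Fin j) := by
      rintro ⟨x⟩ ⟨y⟩ h
      exact Quotient.sound h
    rw [← pat_map _ _ hinj]
    congr 1
    funext i
    simp only [extB, extA]
    split_ifs <;> rfl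
  · intro c
    apply hΘ
    intro i hi i' hi'
    simp only [pat_iff, extB, hi, hi', dif_pos]

/-! ### Reduction of Element Distinctness to collision patterns -/

/-- bit encoding of a function -/
def encX {k : ℕ} (h : Fin (2 ^ k) → Fin (2 ^ k)) (p : Fin (2 ^ k) × Fin k) : Bool :=
  decide ((finFunctionFinEquiv.symm (h p.1) : Fin k → Fin 2) p.2 = 1)

lemma gOf_encX {k : ℕ} (h : Fin (2 ^ k) → Fin (2 ^ k)) : gOf (encX h) = h := by
  funext i
  unfold gOf
  rw [← Equiv.eq_symm_apply]
  funext j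
  simp only [encX, decide_eq_true_eq]
  generalize (finFunctionFinEquiv.symm (h i) : Fin k → Fin 2) j = z
  fin_cases z <;> simp

/-- representative of a class -/
def hrep {V : Type} (r : Setoid V) (i : V) : V := (Quotient.mk r i).out

lemma hrep_iff {V : Type} (r : Setoid V) (i i' : V) : hrep r i = hrep r i' ↔ r i i' := by
  unfold hrep
  constructor
  · intro h
    have := congrArg (Quotient.mk r) h
    rw [Quotient.out_eq, Quotient.out_eq] at this
    exact Quotient.exact this
  · intro h
    rw [Quotient.sound h]

lemma exists_perm {V : Type} [Fintype V] [DecidableEq V] (B : Finset V) (r r' : Setoid V)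
    (h : ∀ i ∈ B, ∀ i' ∈ B, r i i' ↔ r' i i') :
    ∃ σ : Equiv.Perm V, ∀ i ∈ B, σ (hrep r i) = hrep r' i := by
  classical
  let f : V → V := fun u => if h : ∃ i ∈ B, hrep r i = u then hrep r' h.choose else u
  have hf : ∀ i ∈ B, f (hrep r i) = hrep r' i := by
    intro i hi
    have hex : ∃ i' ∈ B, hrep r i' = hrep r i := ⟨i, hi, rfl⟩
    simp only [f]
    rw [dif_pos hex]
    rw [hrep_iff, ← h _ hex.choose_spec.1 _ hi, ← hrep_iff]
    exact hex.choose_spec.2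
  have hinj : Set.InjOn f (B.image (hrep r) : Finset V) := by
    intro u hu u' hu' e
    simp only [coe_image, Set.mem_image, mem_coe] at hu hu'
    obtain ⟨i, hi, rfl⟩ := hu
    obtain ⟨i', hi', rfl⟩ := hu'
    rw [hf i hi, hf i' hi', hrep_iff, ← h i hi i' hi', ← hrep_iff] at e
    exact e
  obtain ⟨g, hg⟩ := Finset.exists_equiv_extend_of_card_eq (t := (univ : Finset V))
    (by simp) (s := B.image (hrep r)) (f := f) (Finset.subset_univ _) hinj
  refine ⟨g.trans (Equiv.subtypeUnivEquiv (fun x => Finset.mem_univ x)), fun i hi => ?_⟩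
  rw [← hf i hi, ← hg _ (Finset.mem_image_of_mem _ hi)]
  rfl

lemma theta_local {k : ℕ} (S : Finset (Fin (2 ^ k) × Fin k)) (r r' : Setoid (Fin (2 ^ k)))
    (h : ∀ i ∈ S.image Prod.fst, ∀ i' ∈ S.image Prod.fst, r i i' ↔ r' i i') :
    ∑ τ : Equiv.Perm (Fin (2 ^ k)), chi S (encX (fun i => τ (hrep r i)))
      = ∑ τ : Equiv.Perm (Fin (2 ^ k)), chi S (encX (fun i => τ (hrep r' i))) := by
  obtain ⟨σ, hσ⟩ := exists_perm _ r r' h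
  refine (Equiv.sum_comp (Equiv.mulRight σ)
    (fun τ : Equiv.Perm (Fin (2 ^ k)) => chi S (encX (fun i => τ (hrep r i))))).symm.trans ?_
  refine Finset.sum_congr rfl fun τ _ => ?_
  unfold chi
  refine Finset.prod_congr rfl fun p hp => ?_
  have e := congrArg τ (hσ _ (Finset.mem_image_of_mem _ hp))
  exact congrArg (fun v : Fin (2 ^ k) => bval (decide ((finFunctionFinEquiv.symm v :
    Fin k → Fin 2) p.2 = 1))) e

lemma ED_encX {k : ℕ} (h : Fin (2 ^ k) → Fin (2 ^ k)) :
    ED k (encX h) = true ↔ Function.Injective h := by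
  unfold ED; rw [gOf_encX]; simp

lemma inj_iff_bot {V : Type} (r : Setoid V) (τ : Equiv.Perm V) :
    Function.Injective (fun i => τ (hrep r i)) ↔ r = ⊥ := by
  constructor
  · intro h
    ext i i'
    constructor
    · intro e
      exact h (congrArg τ ((hrep_iff r i i').2 e))
    · intro e
      have : i = i' := e
      subst this
      exact r.refl i
  · rintro rfl i i' e
    exact (hrep_iff ⊥ i i').1 (τ.injective e)

lemma ed_reduce (k : ℕ) (hk : 1 ≤ k) (D : ℕ) (c : Finset (Fin (2 ^ k) × Fin k) → ℝ) (s : ℝ)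
    (hc : degLE c D)
    (h1 : ∀ x, ED k x = false → polyOf c x < s)
    (h2 : ∀ y x, ED k y = true → ED k x = false →
      s < (2/3) * polyOf c y + (1/3) * polyOf c x) :
    ∃ (Q : ℝ → ℝ → ℝ) (W : Setoid (Fin (2 ^ k)) → ℝ), Good D Q ∧ W ⊥ = 1 ∧
      (∀ r, r ≠ ⊥ → -2 ≤ W r ∧ W r ≤ 0) ∧
      ∀ (j : ℕ) (a : ℝ), ∑ d : Fin (2 ^ k) → Option (Fin j),
        (∏ i, wt j a (d i)) * W (pat d) = Q (j * a) a := by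
  classical
  let xs : Setoid (Fin (2 ^ k)) → Equiv.Perm (Fin (2 ^ k)) → (Fin (2 ^ k) × Fin k → Bool) :=
    fun r τ => encX (fun i => τ (hrep r i))
  let val : Setoid (Fin (2 ^ k)) → ℝ := fun r => ∑ τ, (polyOf c (xs r τ) - s)
  have htrue : ∀ τ, ED k (xs ⊥ τ) = true := fun τ => by
    rw [ED_encX, inj_iff_bot]
  have hfalse : ∀ r, r ≠ ⊥ → ∀ τ, ED k (xs r τ) = false := fun r hr τ => by
    rw [← Bool.not_eq_true, ED_encX, inj_iff_bot]; exact hr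
  have hntop : (⊤ : Setoid (Fin (2 ^ k))) ≠ ⊥ := by
    intro h
    have h2k : 2 ≤ 2 ^ k := by
      calc 2 = 2 ^ 1 := rfl
        _ ≤ 2 ^ k := Nat.pow_le_pow_right (by norm_num) hk
    have : (⊤ : Setoid (Fin (2 ^ k))) ⟨0, by omega⟩ ⟨1, by omega⟩ := trivial
    rw [h] at this
    have h' : (⟨0, by omega⟩ : Fin (2 ^ k)) = ⟨1, by omega⟩ := this
    simp at h'
  have hneg : ∀ r, r ≠ ⊥ → val r ≤ 0 := fun r hr =>
    Finset.sum_nonpos fun τ _ => by linarith [h1 _ (hfalse r hr τ)]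
  have hlow : ∀ r, r ≠ ⊥ → -2 * val ⊥ ≤ val r := fun r hr => by
    simp only [val]
    rw [Finset.mul_sum]
    exact Finset.sum_le_sum fun τ _ => by
      have := h2 _ _ (htrue τ) (hfalse r hr τ)
      linarith
  have hY : 0 < val ⊥ := by
    refine Finset.sum_pos (fun τ _ => ?_) ⟨1, Finset.mem_univ _⟩
    have := h2 _ _ (htrue τ) (hfalse ⊤ hntop τ)
    have := h1 _ (hfalse ⊤ hntop τ)
    linarith
  let Θ : Finset (Fin (2 ^ k) × Fin k) → Setoid (Fin (2 ^ k)) → ℝ :=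
    fun S r => ∑ τ : Equiv.Perm (Fin (2 ^ k)), chi S (xs r τ)
  have hval : ∀ r, val r = (∑ S, c S * Θ S r) + -(∑ τ : Equiv.Perm (Fin (2 ^ k)), s) := by
    intro r
    simp only [val, Θ, Finset.sum_sub_distrib, polyOf, Finset.mul_sum]
    rw [Finset.sum_comm]; ring
  have hloc := fun S => local_poly (S.image Prod.fst) (Θ S)
    (fun r r' h => theta_local S r r' h)
  choose q hq hq' using hloc
  obtain ⟨q0, hq0, hq0'⟩ := local_poly (∅ : Finset (Fin (2 ^ k)))
    (fun _ => -(∑ τ : Equiv.Perm (Fin (2 ^ k)), s)) (fun _ _ _ => rfl)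
  refine ⟨fun w a => (val ⊥)⁻¹ * ((∑ S, c S * q S w a) + q0 w a), fun r => (val ⊥)⁻¹ * val r,
    ?_, ?_, ?_, ?_⟩
  · refine Good.smul _ (Good.add (good_sum _ _ fun S _ => ?_) (hq0.mono (Nat.zero_le _)))
    by_cases hS : D < S.card
    · rw [hc S hS]
      simpa using (good_const 0).mono (Nat.zero_le D)
    · exact ((hq S).mono ((Finset.card_image_le).trans (not_lt.mp hS))).smul _
  · exact inv_mul_cancel₀ hY.ne'
  · intro r hr
    constructor
    · show -2 ≤ (val ⊥)⁻¹ * val r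
      rw [inv_mul_eq_div, le_div_iff₀ hY]; exact hlow r hr
    · exact mul_nonpos_of_nonneg_of_nonpos (inv_nonneg.mpr hY.le) (hneg r hr)
  · intro j a
    show ∑ d : Fin (2 ^ k) → Option (Fin j), (∏ i, wt j a (d i)) * ((val ⊥)⁻¹ * val (pat d))
      = (val ⊥)⁻¹ * ((∑ S, c S * q S (j * a) a) + q0 (j * a) a)
    generalize (val ⊥)⁻¹ = y
    have e1 : ∑ S, c S * q S (j * a) a = ∑ d : Fin (2 ^ k) → Option (Fin j),
        ∑ S, c S * ((∏ i, wt j a (d i)) * Θ S (pat d)) := by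
      rw [Finset.sum_comm]
      refine Finset.sum_congr rfl fun S _ => ?_
      rw [← hq', Finset.mul_sum]
    rw [e1, ← hq0', ← Finset.sum_add_distrib, Finset.mul_sum]
    refine Finset.sum_congr rfl fun d _ => ?_
    rw [hval]
    have e2 : ∑ S, c S * ((∏ i, wt j a (d i)) * Θ S (pat d))
        = (∏ i, wt j a (d i)) * ∑ S, c S * Θ S (pat d) := by
      rw [Finset.mul_sum]
      exact Finset.sum_congr rfl fun S _ => by ring
    rw [e2]; ring

/-! ### Probability of no collision -/

open Classical in
/-- probability that the sample has no collision -/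
def pinj (n j : ℕ) (a : ℝ) : ℝ :=
  ∑ d : Fin n → Option (Fin j), (∏ i, wt j a (d i)) * (if pat d = ⊥ then 1 else 0)

lemma prod_wt_nonneg (n j : ℕ) (a : ℝ) (ha : 0 ≤ a) (hj : j * a ≤ 1)
    (d : Fin n → Option (Fin j)) : 0 ≤ ∏ i, wt j a (d i) :=
  Finset.prod_nonneg fun i _ => wt_nonneg j a ha hj (d i)

lemma sum_prod_wt (n j : ℕ) (a : ℝ) :
    ∑ d : Fin n → Option (Fin j), ∏ i, wt j a (d i) = 1 := by
  rw [← Fintype.prod_sum (fun (_ : Fin n) o => wt j a o)]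
  simp only [wt_sum, Finset.prod_const_one]

lemma pinj_nonneg (n j : ℕ) (a : ℝ) (ha : 0 ≤ a) (hj : j * a ≤ 1) : 0 ≤ pinj n j a :=
  Finset.sum_nonneg fun d _ => mul_nonneg (prod_wt_nonneg n j a ha hj d) (by split_ifs <;> norm_num)

lemma pinj_le_one (n j : ℕ) (a : ℝ) (ha : 0 ≤ a) (hj : j * a ≤ 1) : pinj n j a ≤ 1 := by
  rw [← sum_prod_wt n j a]
  refine Finset.sum_le_sum fun d _ => ?_
  have := prod_wt_nonneg n j a ha hj d
  split_ifs <;> linarith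

lemma exp_upper (n j : ℕ) (a : ℝ) (ha : 0 ≤ a) (hj : j * a ≤ 1) (W : Setoid (Fin n) → ℝ)
    (h1 : W ⊥ = 1) (h2 : ∀ r, r ≠ ⊥ → -2 ≤ W r ∧ W r ≤ 0) :
    ∑ d : Fin n → Option (Fin j), (∏ i, wt j a (d i)) * W (pat d) ≤ pinj n j a := by
  refine Finset.sum_le_sum fun d _ => ?_
  refine mul_le_mul_of_nonneg_left ?_ (prod_wt_nonneg n j a ha hj d)
  split_ifs with h
  · rw [h, h1]
  · exact (h2 _ h).2

lemma exp_lower (n j : ℕ) (a : ℝ) (ha : 0 ≤ a) (hj : j * a ≤ 1) (W : Setoid (Fin n) → ℝ)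
    (h1 : W ⊥ = 1) (h2 : ∀ r, r ≠ ⊥ → -2 ≤ W r ∧ W r ≤ 0) :
    3 * pinj n j a - 2 ≤ ∑ d : Fin n → Option (Fin j), (∏ i, wt j a (d i)) * W (pat d) := by
  have e : (2:ℝ) = ∑ d : Fin n → Option (Fin j), 2 * ∏ i, wt j a (d i) := by
    rw [← Finset.mul_sum, sum_prod_wt]; norm_num
  rw [e, pinj, Finset.mul_sum, ← Finset.sum_sub_distrib]
  refine Finset.sum_le_sum fun d _ => ?_
  have hp := prod_wt_nonneg n j a ha hj d
  split_ifs with h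
  · rw [h, h1]; linarith
  · nlinarith [(h2 _ h).1]

lemma pat_extA {V : Type} [DecidableEq V] (A : Finset V) (j : ℕ) (v : A → Fin j) :
    pat (extA A v) = ⊥ ↔ Function.Injective v := by
  constructor
  · intro h x y e
    have h1 : (pat (extA A v)) x.1 y.1 := by
      rw [pat_iff]
      right
      simp [extA, e]
    rw [h] at h1
    exact Subtype.ext h1
  · intro hv
    ext i i'
    rw [pat_iff]
    constructor
    · rintro (h | ⟨h, h'⟩)
      · exact h
      · simp only [extA] at h h'
        by_cases hi : i ∈ A
        · by_cases hi' : i' ∈ A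
          · simp only [hi, hi', dif_pos, Option.some.injEq] at h
            have := hv h
            exact congrArg Subtype.val this
          · simp [hi, hi'] at h
        · simp [hi] at h'
    · intro h
      left; exact h

lemma pinj_formula (n j : ℕ) (a : ℝ) :
    pinj n j a = ∑ A : Finset (Fin n), (1 - j * a) ^ (n - A.card) *
      (a ^ A.card * (j.descFactorial A.card : ℝ)) := by
  classical
  unfold pinj
  rw [sum_decomp]
  refine Finset.sum_congr rfl fun A _ => ?_
  rw [Fintype.card_fin]
  congr 2
  simp only [pat_extA]
  rw [Finset.sum_boole]
  congr 1
  rw [← Fintype.card_subtype, Fintype.card_congr (Equiv.subtypeInjectiveEquivEmbedding A (Fin j)),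
    Fintype.card_embedding_eq, Fintype.card_fin, Fintype.card_coe]

lemma pinj_half (n j : ℕ) (hj : 1 ≤ j) :
    pinj n j (1 / (2 * j)) = ∑ A : Finset (Fin n), (1/2:ℝ) ^ n *
      ((j.descFactorial A.card : ℝ) / (j:ℝ) ^ A.card) := by
  rw [pinj_formula]
  refine Finset.sum_congr rfl fun A _ => ?_
  have hA : A.card ≤ n := by simpa using Finset.card_le_univ A
  have hj' : (j:ℝ) ≠ 0 := by positivity
  have e : 1 - (j:ℝ) * (1 / (2 * j)) = 1/2 := by field_simp; norm_num
  have e2 : (1:ℝ) / (2 * j) = (1/2) * (j:ℝ)⁻¹ := by field_simp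
  have e3 : (1/2:ℝ) ^ n = (1/2) ^ (n - A.card) * (1/2) ^ A.card := by
    rw [← pow_add, Nat.sub_add_cancel hA]
  rw [e, e2, mul_pow, e3, inv_pow, div_eq_mul_inv (j.descFactorial A.card : ℝ)]
  ring

lemma desc_upper (j u : ℕ) :
    (j.descFactorial u : ℝ) * (2 * j + u * (u - 1)) ≤ 2 * (j:ℝ) ^ (u + 1) := by
  induction u with
  | zero => simp
  | succ u ih =>
    by_cases h : j ≤ u
    · rw [Nat.descFactorial_succ, Nat.sub_eq_zero_of_le h]
      simp
    · push Not at h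
      rw [Nat.descFactorial_succ]
      push_cast [Nat.cast_sub h.le]
      have h0 : (0:ℝ) ≤ (j.descFactorial u : ℝ) := Nat.cast_nonneg _
      have h1 : ((j:ℝ) - u) * (2 * j + (u + 1) * (u + 1 - 1)) ≤ j * (2 * j + u * (u - 1)) := by
        have : (0:ℝ) ≤ (u:ℝ)^2 * (u + 1) := by positivity
        nlinarith
      calc ((j:ℝ) - u) * (j.descFactorial u : ℝ) * (2 * j + (u + 1) * (u + 1 - 1))
          = (j.descFactorial u : ℝ) * (((j:ℝ) - u) * (2 * j + (u + 1) * (u + 1 - 1))) := by ring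
        _ ≤ (j.descFactorial u : ℝ) * (j * (2 * j + u * (u - 1))) :=
            mul_le_mul_of_nonneg_left h1 h0
        _ = j * ((j.descFactorial u : ℝ) * (2 * j + u * (u - 1))) := by ring
        _ ≤ j * (2 * (j:ℝ) ^ (u + 1)) := mul_le_mul_of_nonneg_left ih (Nat.cast_nonneg _)
        _ = 2 * (j:ℝ) ^ (u + 1 + 1) := by ring

lemma desc_lower (j u : ℕ) :
    (j:ℝ) ^ u * (j - (u:ℝ) ^ 2) ≤ j * (j.descFactorial u : ℝ) := by
  induction u with
  | zero => simp
  | succ u ih =>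
    by_cases h : j ≤ u
    · have h' : (j:ℝ) ≤ u := by exact_mod_cast h
      have : (j:ℝ) - ((u + 1 : ℕ):ℝ) ^ 2 ≤ 0 := by
        push_cast; nlinarith [Nat.cast_nonneg (α := ℝ) u]
      exact (mul_nonpos_of_nonneg_of_nonpos (by positivity) this).trans (by positivity)
    · push Not at h
      have h' : (u:ℝ) < j := by exact_mod_cast h
      rw [Nat.descFactorial_succ]
      push_cast [Nat.cast_sub h.le]
      have h1 : (j:ℝ) * (j - (u + 1) ^ 2) ≤ (j - u) * (j - (u:ℝ)^2) := by
        have : (0:ℝ) ≤ (u:ℝ)^3 := by positivity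
        have : (0:ℝ) ≤ (j:ℝ)*u := by positivity
        have : (0:ℝ) ≤ j := by positivity
        nlinarith
      calc (j:ℝ) ^ (u + 1) * (j - (u + 1) ^ 2) = (j:ℝ)^u * (j * (j - (u + 1) ^ 2)) := by ring
        _ ≤ (j:ℝ)^u * ((j - u) * (j - (u:ℝ)^2)) := mul_le_mul_of_nonneg_left h1 (by positivity)
        _ = (j - u) * ((j:ℝ)^u * (j - (u:ℝ)^2)) := by ring
        _ ≤ (j - u) * (j * (j.descFactorial u : ℝ)) :=
            mul_le_mul_of_nonneg_left ih (by linarith)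
        _ = _ := by ring

lemma pinj_low (n : ℕ) (hn : 1 ≤ n) : (999/1000 : ℝ) ≤ pinj n (1000 * n ^ 2)
    (1 / (2 * ((1000 * n ^ 2 : ℕ) : ℝ))) := by
  have hj : 1 ≤ 1000 * n ^ 2 := by nlinarith
  rw [pinj_half _ _ hj]
  set j := 1000 * n ^ 2 with hjd
  have hj0 : (0:ℝ) < j := by exact_mod_cast hj
  have hjr : (j:ℝ) = 1000 * (n:ℝ)^2 := by rw [hjd]; push_cast; ring
  calc (999/1000:ℝ) = ∑ A : Finset (Fin n), (1/2:ℝ) ^ n * (999/1000) := by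
        rw [Finset.sum_const, Finset.card_univ, Fintype.card_finset, Fintype.card_fin,
          nsmul_eq_mul]
        push_cast
        rw [← mul_assoc, ← mul_pow]; norm_num
    _ ≤ _ := by
        refine Finset.sum_le_sum fun A _ => mul_le_mul_of_nonneg_left ?_ (by positivity)
        have hA : A.card ≤ n := by simpa using Finset.card_le_univ A
        have hA' : (A.card:ℝ) ≤ n := by exact_mod_cast hA
        rw [le_div_iff₀ (by positivity)]
        have h := desc_lower j A.card
        have h2 : (j:ℝ) * (999/1000) ≤ j - (A.card:ℝ)^2 := by
          have : (A.card:ℝ)^2 ≤ (n:ℝ)^2 := pow_le_pow_left₀ (by positivity) hA' 2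
          linarith
        have h3 := (mul_le_mul_of_nonneg_left h2 (by positivity : (0:ℝ) ≤ (j:ℝ)^A.card)).trans h
        refine le_of_mul_le_mul_left ?_ hj0
        linarith

lemma desc_div_le_one (j u : ℕ) (hj : 1 ≤ j) : (j.descFactorial u : ℝ) / (j:ℝ) ^ u ≤ 1 := by
  have : (0:ℝ) < j := by exact_mod_cast hj
  rw [div_le_one (by positivity)]
  exact_mod_cast Nat.descFactorial_le_pow j u

lemma desc_div_le (n u : ℕ) (hn : 4 ≤ n) (hu : n ≤ 2 * u) :
    ((n^2).descFactorial u : ℝ) / ((n^2 : ℕ):ℝ) ^ u ≤ 16/17 := by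
  have hn' : (4:ℝ) ≤ n := by exact_mod_cast hn
  have hu' : (n:ℝ) ≤ 2 * u := by exact_mod_cast hu
  have h := desc_upper (n^2) u
  have hj0 : (0:ℝ) < ((n^2:ℕ):ℝ) := by push_cast; positivity
  rw [div_le_iff₀ (by positivity)]
  have h2 : ((n^2:ℕ):ℝ) * (17/8) ≤ 2 * ((n^2:ℕ):ℝ) + u * (u - 1) := by
    push_cast
    nlinarith
  have h3 := (mul_le_mul_of_nonneg_left h2
    (by positivity : (0:ℝ) ≤ ((n^2).descFactorial u : ℝ))).trans h
  rw [pow_succ (((n^2:ℕ):ℝ)) u] at h3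
  refine le_of_mul_le_mul_left ?_ hj0
  linarith

lemma pinj_up (n : ℕ) (hn : 4 ≤ n) : pinj n (n ^ 2)
    (1 / (2 * ((n ^ 2 : ℕ) : ℝ))) ≤ 33/34 := by
  have hj : 1 ≤ n ^ 2 := by nlinarith
  rw [pinj_half _ _ hj]
  have hc : ∑ A : Finset (Fin n), (1/2:ℝ) ^ n *
      (((n^2).descFactorial A.card : ℝ) / ((n^2:ℕ):ℝ) ^ A.card)
      = ∑ A : Finset (Fin n), (1/2:ℝ) ^ n *
      (((n^2).descFactorial Aᶜ.card : ℝ) / ((n^2:ℕ):ℝ) ^ Aᶜ.card) :=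
    (Equiv.sum_comp (Function.Involutive.toPerm (compl : Finset (Fin n) → Finset (Fin n))
      compl_involutive) (fun A : Finset (Fin n) => (1/2:ℝ) ^ n *
      (((n^2).descFactorial A.card : ℝ) / ((n^2:ℕ):ℝ) ^ A.card))).symm
  have hs : ∑ A : Finset (Fin n), (1/2:ℝ) ^ n *
      (((n^2).descFactorial A.card : ℝ) / ((n^2:ℕ):ℝ) ^ A.card)
      + ∑ A : Finset (Fin n), (1/2:ℝ) ^ n *
      (((n^2).descFactorial Aᶜ.card : ℝ) / ((n^2:ℕ):ℝ) ^ Aᶜ.card) ≤ 33/17 := by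
    rw [← Finset.sum_add_distrib]
    calc _ ≤ ∑ A : Finset (Fin n), (1/2:ℝ) ^ n * (33/17) := by
          refine Finset.sum_le_sum fun A _ => ?_
          rw [← mul_add]
          refine mul_le_mul_of_nonneg_left ?_ (by positivity)
          have hA : A.card + Aᶜ.card = n := by simp
          have g1 := desc_div_le_one (n^2) A.card hj
          have g2 := desc_div_le_one (n^2) Aᶜ.card hj
          by_cases h : n ≤ 2 * A.card
          · have := desc_div_le n _ hn h
            linarith
          · have := desc_div_le n Aᶜ.card hn (by omega)
            linarith
      _ = 33/17 := by
        rw [Finset.sum_const, Finset.card_univ, Fintype.card_finset, Fintype.card_fin,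
          nsmul_eq_mul]
        push_cast
        rw [← mul_assoc, ← mul_pow]; norm_num
  linarith

/-! ### The analytic argument -/

lemma half_bound (D : ℕ) (hD : 1 ≤ D) (Q : ℝ → ℝ → ℝ) (hQ : Good D Q)
    (hb : ∀ (j : ℕ) (a : ℝ), 0 ≤ a → j * a ≤ 1 → |Q (j * a) a| ≤ 2)
    (a : ℝ) (ha : 0 < a) (ha' : a ≤ 1 / (8 * D)) :
    |Q (1/2) a| ≤ 2 * (2 + (harmonic D : ℝ)) := by
  have hD' : (1:ℝ) ≤ D := by exact_mod_cast hD
  have haD : a * (8 * D) ≤ 1 := by rwa [le_div_iff₀ (by positivity)] at ha'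
  obtain ⟨p, hp, he⟩ := hQ.2 a
  set x0 : ℝ := 1 / (2 * a) with hx0
  have hx0a : x0 * a = 1/2 := by rw [hx0]; field_simp
  have hx0p : 0 ≤ x0 := by positivity
  have hle : (4 * D : ℝ) ≤ x0 := by
    rw [hx0, le_div_iff₀ (by positivity)]; linarith
  set m := ⌊x0⌋₊ with hm
  have hm1 : (m:ℝ) ≤ x0 := Nat.floor_le hx0p
  have hm2 : x0 < m + 1 := Nat.lt_floor_add_one x0
  have hmD : D ≤ m := by
    apply Nat.le_floor; linarith
  have hl := lebesgue p D (by omega) 2 ((m - D : ℕ) : ℝ) (fun i hi => by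
    have hh := hb (m - D + i) a ha.le (by
      have h1 : ((m - D + i : ℕ) : ℝ) ≤ x0 + 2 * D := by
        have : m - D + i ≤ m + 2 * D := by omega
        have : ((m - D + i : ℕ) : ℝ) ≤ m + 2 * D := by exact_mod_cast this
        linarith
      have h2 := mul_le_mul_of_nonneg_right h1 ha.le
      nlinarith)
    rw [he]
    have e : ((m - D + i : ℕ) : ℝ) = ((m - D : ℕ) : ℝ) + i := by push_cast; ring
    rw [← e]; exact hh) (x0 - m) (by linarith) (by linarith)
  have e : ((m - D : ℕ) : ℝ) + D + (x0 - m) = x0 := by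
    rw [Nat.cast_sub hmD]; ring
  rw [e, he, hx0a] at hl
  exact hl

lemma gap_bound (D : ℕ) (hD : 1 ≤ D) (Q : ℝ → ℝ → ℝ) (hQ : Good D Q)
    (hb : ∀ (j : ℕ) (a : ℝ), 0 ≤ a → j * a ≤ 1 → |Q (j * a) a| ≤ 2)
    (a0 a1 : ℝ) (h0 : 0 < a0) (h01 : a0 < a1) (h1 : a1 ≤ 1 / (16 * D)) :
    |Q (1/2) a1 - Q (1/2) a0| ≤ 32 * (D:ℝ)^3 * (2 * (2 + (harmonic D : ℝ))) * a1 := by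
  have hD' : (1:ℝ) ≤ D := by exact_mod_cast hD
  obtain ⟨R, hR, he⟩ := hQ.1 (1/2)
  set T : ℝ := 2 * (2 + (harmonic D : ℝ)) with hT
  have hTp : 0 < T := by
    have : (0:ℝ) ≤ (harmonic D : ℝ) := by
      have : (0:ℚ) ≤ harmonic D := by
        unfold harmonic; positivity
      exact_mod_cast this
    rw [hT]; linarith
  have hL : (1:ℝ) / (8 * D) = 2 * (1 / (16 * D)) := by field_simp; norm_num
  have hpos : (0:ℝ) < 1 / (16 * D) := by positivity
  have hder : ∀ x ∈ Set.Icc a0 a1, ‖R.derivative.eval x‖ ≤ 32 * (D:ℝ)^3 * T := by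
    intro x hx
    rw [Real.norm_eq_abs]
    have hm := markov_left R D hR x (1 / (8 * D)) T (by linarith [hx.2]) hTp (fun y hy hy' => by
      rw [he]
      exact half_bound D hD Q hQ hb y (by linarith [hx.1]) hy')
    refine hm.trans ?_
    have h2 : 2 * T / (1 / (8 * D) - x) ≤ 2 * T / (1 / (16 * D)) := by
      apply div_le_div_of_nonneg_left (by positivity) hpos
      linarith [hx.2]
    calc (D:ℝ)^2 * (2 * T / (1 / (8 * D) - x)) ≤ (D:ℝ)^2 * (2 * T / (1 / (16 * D))) :=
          mul_le_mul_of_nonneg_left h2 (by positivity)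
      _ = 32 * (D:ℝ)^3 * T := by field_simp; norm_num
  have hmv := Convex.norm_image_sub_le_of_norm_hasDerivWithin_le (f := fun x => R.eval x)
    (f' := fun x => R.derivative.eval x) (fun x _ => (R.hasDerivAt x).hasDerivWithinAt) hder
    (convex_Icc a0 a1) (Set.left_mem_Icc.2 h01.le) (Set.right_mem_Icc.2 h01.le)
  simp only [he, Real.norm_eq_abs] at hmv
  refine hmv.trans (mul_le_mul_of_nonneg_left ?_ (by positivity))
  rw [abs_of_pos (by linarith)]; linarith

/-- main inequality -/
lemma ed_core (k : ℕ) (hk : 2 ≤ k) (D : ℕ) (hD : 1 ≤ D) (hDn : 8 * D ≤ (2 ^ k) ^ 2)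
    (c : Finset (Fin (2 ^ k) × Fin k) → ℝ) (s : ℝ)
    (hc : degLE c D)
    (h1 : ∀ x, ED k x = false → polyOf c x < s)
    (h2 : ∀ y x, ED k y = true → ED k x = false →
      s < (2/3) * polyOf c y + (1/3) * polyOf c x) :
    (1/40 : ℝ) * ((2 ^ k : ℕ) : ℝ) ^ 2 ≤ 16 * (D:ℝ)^3 * (2 * (2 + (harmonic D : ℝ))) := by
  obtain ⟨Q, W, hQ, hW1, hW2, hQW⟩ := ed_reduce k (by omega) D c s hc h1 h2
  have hn : 4 ≤ 2 ^ k := by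
    calc 4 = 2 ^ 2 := rfl
      _ ≤ 2 ^ k := Nat.pow_le_pow_right (by norm_num) hk
  clear h1 h2 hc c
  generalize 2 ^ k = n at *
  have hn' : (4:ℝ) ≤ n := by exact_mod_cast hn
  have hD' : (1:ℝ) ≤ D := by exact_mod_cast hD
  have hDn' : 8 * (D:ℝ) ≤ (n:ℝ)^2 := by exact_mod_cast hDn
  have hb : ∀ (j : ℕ) (a : ℝ), 0 ≤ a → j * a ≤ 1 → |Q (j * a) a| ≤ 2 := by
    intro j a ha hj
    have e1 := exp_upper n j a ha hj W hW1 hW2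
    have e2 := exp_lower n j a ha hj W hW1 hW2
    rw [hQW] at e1 e2
    have e3 := pinj_le_one n j a ha hj
    have e4 := pinj_nonneg n j a ha hj
    rw [abs_le]; constructor <;> linarith
  have hup : Q (1/2) (1 / (2 * ((n ^ 2 : ℕ) : ℝ))) ≤ 33/34 := by
    have hj : ((n ^ 2 : ℕ) : ℝ) * (1 / (2 * ((n ^ 2 : ℕ) : ℝ))) = 1/2 := by
      push_cast; field_simp
    have e1 := exp_upper n (n^2) (1 / (2 * ((n ^ 2 : ℕ) : ℝ))) (by positivity)
      (by rw [hj]; norm_num) W hW1 hW2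
    rw [hQW, hj] at e1
    exact e1.trans (pinj_up n hn)
  have hlo : 997/1000 ≤ Q (1/2) (1 / (2 * ((1000 * n ^ 2 : ℕ) : ℝ))) := by
    have hj : ((1000 * n ^ 2 : ℕ) : ℝ) * (1 / (2 * ((1000 * n ^ 2 : ℕ) : ℝ))) = 1/2 := by
      push_cast; field_simp
    have e1 := exp_lower n (1000 * n^2) (1 / (2 * ((1000 * n ^ 2 : ℕ) : ℝ))) (by positivity)
      (by rw [hj]; norm_num) W hW1 hW2
    rw [hQW, hj] at e1
    have := pinj_low n (by omega)
    linarith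
  have hg := gap_bound D hD Q hQ hb (1 / (2 * ((1000 * n ^ 2 : ℕ) : ℝ)))
    (1 / (2 * ((n ^ 2 : ℕ) : ℝ))) (by positivity) (by
      push_cast
      apply one_div_lt_one_div_of_lt (by positivity)
      nlinarith) (by
      push_cast
      apply one_div_le_one_div_of_le (by positivity)
      linarith)
  have hg2 := (neg_le_abs _).trans hg
  have hg3 : (1/40:ℝ) ≤ 32 * (D:ℝ)^3 * (2 * (2 + (harmonic D : ℝ))) *
    (1 / (2 * ((n ^ 2 : ℕ) : ℝ))) := by linarith
  push_cast at hg3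
  have e : 32 * (D:ℝ)^3 * (2 * (2 + (harmonic D : ℝ))) * (1 / (2 * (n:ℝ) ^ 2))
    = 16 * (D:ℝ)^3 * (2 * (2 + (harmonic D : ℝ))) / (n:ℝ)^2 := by field_simp; ring
  rw [e, le_div_iff₀ (by positivity)] at hg3
  exact hg3

lemma ed_zero (k : ℕ) (hk : 1 ≤ k) (c : Finset (Fin (2 ^ k) × Fin k) → ℝ) (s : ℝ)
    (hc : degLE c 0)
    (h1 : ∀ x, ED k x = false → polyOf c x < s)
    (h2 : ∀ y x, ED k y = true → ED k x = false →
      s < (2/3) * polyOf c y + (1/3) * polyOf c x) : False := by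
  have hconst : ∀ x, polyOf c x = c ∅ := by
    intro x
    unfold polyOf
    rw [Finset.sum_eq_single ∅]
    · simp [chi]
    · intro S _ hS
      rw [hc S (Finset.card_pos.2 (Finset.nonempty_iff_ne_empty.2 hS)), zero_mul]
    · simp
  have h2k : 2 ≤ 2 ^ k := by
    calc 2 = 2 ^ 1 := rfl
      _ ≤ 2 ^ k := Nat.pow_le_pow_right (by norm_num) hk
  have hy : ED k (encX id) = true := by
    rw [ED_encX]; exact Function.injective_id
  have hx : ED k (encX (fun _ => ⟨0, by omega⟩)) = false := by
    rw [← Bool.not_eq_true, ED_encX]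
    intro h
    have := @h ⟨0, by omega⟩ ⟨1, by omega⟩ rfl
    simp at this
  have e1 := h1 _ hx
  have e2 := h2 _ _ hy hx
  rw [hconst] at e1
  rw [hconst, hconst] at e2
  linarith

lemma rpow_cube (n : ℕ) : (((n:ℝ)) ^ ((2 : ℝ) / 3)) ^ 3 = (n:ℝ)^2 := by
  rw [← Real.rpow_natCast, ← Real.rpow_mul (Nat.cast_nonneg n)]
  norm_num

lemma final_arith (k : ℕ) (hk : 1 ≤ k) (D : ℕ) (hD : 1 ≤ D)
    (h : (D:ℝ) < (1/20) * ((2 ^ k : ℕ) : ℝ) ^ ((2 : ℝ) / 3) / (k : ℝ)) :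
    8 * D ≤ (2 ^ k) ^ 2 ∧
    16 * (D:ℝ)^3 * (2 * (2 + (harmonic D : ℝ))) < (1/40 : ℝ) * ((2 ^ k : ℕ) : ℝ) ^ 2 := by
  have hk' : (1:ℝ) ≤ k := by exact_mod_cast hk
  have hD' : (1:ℝ) ≤ D := by exact_mod_cast hD
  set n := 2 ^ k with hn
  have hnr : (n:ℝ) = 2 ^ k := by rw [hn]; push_cast; ring
  have hn1 : (1:ℝ) ≤ n := by rw [hnr]; exact one_le_pow₀ (by norm_num)
  rw [lt_div_iff₀ (by positivity)] at h
  have h3 : ((D:ℝ) * k)^3 < (1/8000) * (n:ℝ)^2 := by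
    have := pow_lt_pow_left₀ h (by positivity) (n := 3) (by norm_num)
    rw [mul_pow (1/20:ℝ), rpow_cube] at this
    norm_num at this ⊢
    exact this
  have hk3 : (k:ℝ) ≤ (k:ℝ)^3 := le_self_pow₀ hk' (by norm_num)
  have hD3 : (D:ℝ) ≤ (D:ℝ)^3 := le_self_pow₀ hD' (by norm_num)
  have h4 : (D:ℝ)^3 * k < (1/8000) * (n:ℝ)^2 := by
    rw [mul_pow] at h3
    exact (mul_le_mul_of_nonneg_left hk3 (by positivity)).trans_lt h3
  have h5 : (D:ℝ)^3 < (1/8000) * (n:ℝ)^2 := by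
    refine lt_of_le_of_lt ?_ h4
    exact le_mul_of_one_le_right (by positivity) hk'
  constructor
  · have : 8 * (D:ℝ) ≤ (n:ℝ)^2 := by nlinarith
    exact_mod_cast this
  · have hDn : (D:ℝ) ≤ n := by
      by_contra hcon
      push Not at hcon
      have : (n:ℝ)^2 ≤ (D:ℝ)^2 := pow_le_pow_left₀ (by positivity) hcon.le 2
      have : (D:ℝ)^2 ≤ (D:ℝ)^3 := pow_le_pow_right₀ hD' (by norm_num)
      nlinarith
    have hlog : Real.log D ≤ k := by
      calc Real.log D ≤ Real.log n := Real.log_le_log (by linarith) hDn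
        _ = k * Real.log 2 := by rw [hnr, Real.log_pow]
        _ ≤ k * 1 := mul_le_mul_of_nonneg_left (by linarith [Real.log_two_lt_d9]) (by positivity)
        _ = k := mul_one _
    have hh : (harmonic D : ℝ) ≤ 1 + Real.log D := harmonic_le_one_add_log D
    have hT : 2 * (2 + (harmonic D : ℝ)) ≤ 8 * k := by linarith
    calc 16 * (D:ℝ)^3 * (2 * (2 + (harmonic D : ℝ))) ≤ 16 * (D:ℝ)^3 * (8 * k) :=
          mul_le_mul_of_nonneg_left hT (by positivity)
      _ = 128 * ((D:ℝ)^3 * k) := by ring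
      _ < (1/40 : ℝ) * (n:ℝ) ^ 2 := by nlinarith

/-- for some constant `c > 0`, for all `N = 2^k ≥ 2` and `t ≥ 1`,
the `(1 - 2^{-t})`-approximate degree of `OR_t(ED_N, …, ED_N)` is at least
`c · N^{2/3} / log₂ N`. -/
theorem or_ed_approx_degree :
    ∃ c : ℝ, 0 < c ∧ ∀ k : ℕ, 1 ≤ k → ∀ t : ℕ, 1 ≤ t →
      c * ((2 ^ k : ℕ) : ℝ) ^ ((2 : ℝ) / 3) / (k : ℝ)
        ≤ (adeg (1 - (1/2) ^ t) (orBlock t (ED k)) : ℝ) := by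
  refine ⟨1/20, by norm_num, fun k hk t ht => ?_⟩
  by_contra hcon
  push Not at hcon
  have hε : (0:ℝ) ≤ 1 - (1/2) ^ t := by
    have : ((1:ℝ)/2) ^ t ≤ 1 := pow_le_one₀ (by norm_num) (by norm_num)
    linarith
  obtain ⟨c, hc, hap⟩ := adeg_spec _ hε (orBlock t (ED k))
  generalize adeg (1 - (1/2) ^ t) (orBlock t (ED k)) = D at *
  refine amplification (ED k) D t ht c hc hap ?_
  intro c' s hc' h1 h2
  rcases Nat.eq_zero_or_pos D with hD | hD
  · subst hD
    exact ed_zero k hk c' s hc' h1 h2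
  · obtain ⟨e1, e2⟩ := final_arith k hk D hD hcon
    by_cases hk2 : 2 ≤ k
    · have := ed_core k hk2 D hD e1 c' s hc' h1 h2
      linarith
    · have : k = 1 := by omega
      subst this
      omega

end
end
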